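/- arXiv:0810.2754 — 2 statements merged into one kernel-verified Lean document; each statement's English description precedes it below -/
import Mathlib

section
/- Let X be a homogeneous polynomial vector field on S² of degree 2. If X has at least one non-hyperbolic singularity on S² that is not a weak focus, then X has no limit cycles on S². -/
open MvPolynomial

/-- The sphere `S² ⊆ ℝ³`. -/
def S2 : Set (Fin 3 → ℝ) := {p | p 0 ^ 2 + p 1 ^ 2 + p 2 ^ 2 = 1}

/-- The vector field in `ℝ³` associated to the polynomials `P`, `Q`, `R`. -/
noncomputable def Xf (P Q R : MvPolynomial (Fin 3) ℝ) (p : Fin 3 → ℝ) : Fin 3 → ℝ :=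
  ![eval p P, eval p Q, eval p R]

/-- `Γ` is a periodic orbit of the vector field `X` on `S²`: the image of a nonconstant
periodic solution of `X` contained in `S²`. -/
def IsPeriodicOrbitOn (X : (Fin 3 → ℝ) → (Fin 3 → ℝ)) (Γ : Set (Fin 3 → ℝ)) : Prop :=
  ∃ (γ : ℝ → Fin 3 → ℝ) (T : ℝ),
    (∀ t, HasDerivAt γ (X (γ t)) t) ∧ 0 < T ∧ (∀ t, γ (t + T) = γ t) ∧
    (¬ ∀ t, γ t = γ 0) ∧ Set.range γ ⊆ S2 ∧ Γ = Set.range γ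

open Matrix

/-- `Γ` is a limit cycle of `X` on `S²`: a periodic orbit isolated in the set of all periodic
orbits of `X` on `S²`. -/
def IsLimitCycleOn (X : (Fin 3 → ℝ) → (Fin 3 → ℝ)) (Γ : Set (Fin 3 → ℝ)) : Prop :=
  IsPeriodicOrbitOn X Γ ∧ ∃ U : Set (Fin 3 → ℝ), IsOpen U ∧ Γ ⊆ U ∧
    ∀ Γ', IsPeriodicOrbitOn X Γ' → Γ' ⊆ U → Γ' = Γ

/-- The planar system (†) obtained by central projection at `(0,0,-1)` of the normal form (★)
with `a₃ = a₆ = 0`. -/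
def sysDagger (a1 a2 a4 a5 a7 a8 : ℝ) : ℝ × ℝ → ℝ × ℝ := fun w =>
  (-a4 * w.1 - a5 * w.2 + a1 * w.1 * w.2 + a2 * w.2 ^ 2 - a4 * w.1 ^ 3
      - (a5 + a7) * w.1 ^ 2 * w.2 - a8 * w.1 * w.2 ^ 2,
   -a7 * w.1 - a8 * w.2 - a1 * w.1 ^ 2 - a2 * w.1 * w.2 - a4 * w.1 ^ 2 * w.2
      - (a5 + a7) * w.1 * w.2 ^ 2 - a8 * w.2 ^ 3)

/-- A singular point `q` of a planar vector field `f` is a center if it has a punctured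
neighborhood in which every orbit is a (nonconstant) periodic orbit surrounding `q`
(i.e. `q` lies in a bounded component of the complement of the orbit). -/
def IsCenter (f : ℝ × ℝ → ℝ × ℝ) (q : ℝ × ℝ) : Prop :=
  f q = 0 ∧ ∃ U ∈ nhds q, ∀ p ∈ U, p ≠ q →
    ∃ (γ : ℝ → ℝ × ℝ) (T : ℝ),
      γ 0 = p ∧ (∀ t, HasDerivAt γ (f (γ t)) t) ∧ 0 < T ∧ (∀ t, γ (t + T) = γ t) ∧
      (¬ ∀ t, γ t = γ 0) ∧ q ∉ Set.range γ ∧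
      Bornology.IsBounded (connectedComponentIn (Set.range γ)ᶜ q)


open Set Filter Topology
open scoped NNReal

/-- A bounded globally Lipschitz vector field on a Banach space has global solutions. -/
theorem exists_global_solution {E : Type*} [NormedAddCommGroup E] [NormedSpace ℝ E]
    [CompleteSpace E] {v : E → E} {K L : ℝ≥0} (hK : LipschitzWith K v) (hL : ∀ x, ‖v x‖ ≤ L)
    (x₀ : E) : ∃ γ : ℝ → E, γ 0 = x₀ ∧ ∀ t, HasDerivAt γ (v (γ t)) t := by
  have hloc : ∀ a : ℝ, 0 < a → ∃ γ : ℝ → E, γ 0 = x₀ ∧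
      ∀ t ∈ Ioo (-a) a, HasDerivAt γ (v (γ t)) t := by
    intro a ha
    have hpl : IsPicardLindelof (fun _ ↦ v) (⟨0, by constructor <;> linarith⟩ : Icc (-a) a) x₀
        (L * a.toNNReal) 0 L K := by
      refine IsPicardLindelof.of_time_independent (fun x _ ↦ hL x) hK.lipschitzOnWith ?_
      simp [ha.le]
    obtain ⟨γ, h0, h⟩ := hpl.exists_eq_forall_mem_Icc_hasDerivWithinAt₀
    exact ⟨γ, h0, fun t ht ↦ (h t (Ioo_subset_Icc_self ht)).hasDerivAt (Icc_mem_nhds ht.1 ht.2)⟩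
  choose! γ hγ0 hγ using hloc
  have heq : ∀ a b : ℝ, 0 < a → a ≤ b → EqOn (γ a) (γ b) (Ioo (-a) a) := by
    intro a b ha hab
    refine ODE_solution_unique_of_mem_Ioo (v := fun _ ↦ v) (s := fun _ ↦ univ) (K := K) (t₀ := 0)
      (fun _ _ ↦ hK.lipschitzOnWith) ⟨by linarith, ha⟩ (fun t ht ↦ ⟨hγ a ha t ht, trivial⟩)
      (fun t ht ↦ ⟨hγ b (ha.trans_le hab) t ⟨by linarith [ht.1], by linarith [ht.2]⟩, trivial⟩) ?_
    rw [hγ0 a ha, hγ0 b (ha.trans_le hab)]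
  refine ⟨fun t ↦ γ (|t| + 1) t, hγ0 _ (by positivity), fun t ↦ ?_⟩
  have hmem : t ∈ Ioo (-(|t| + 1)) (|t| + 1) := abs_lt.1 (by linarith)
  refine (hγ (|t| + 1) (by positivity) t hmem).congr_of_eventuallyEq ?_
  filter_upwards [Ioo_mem_nhds hmem.1 hmem.2] with s hs
  rcases le_total (|s| + 1) (|t| + 1) with h | h
  · exact heq _ _ (by positivity) h (abs_lt.1 (by linarith))
  · exact (heq _ _ (by positivity) h hs).symm

/-- The scalar product of `ℝ³`, in coordinates. -/
def dot3 (p q : Fin 3 → ℝ) : ℝ := p 0 * q 0 + p 1 * q 1 + p 2 * q 2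

/-- A field tangent to all spheres centred at the origin agrees on `S²` with a globally Lipschitz
field whose solutions starting on `S²` are global and stay there. -/
theorem exists_lipschitz_extension_flow {X : (Fin 3 → ℝ) → (Fin 3 → ℝ)} (hX : ContDiff ℝ 1 X)
    (htan : ∀ p, dot3 p (X p) = 0) :
    ∃ (K : ℝ≥0) (v : (Fin 3 → ℝ) → (Fin 3 → ℝ)), LipschitzWith K v ∧ (∀ p ∈ S2, v p = X p) ∧
      ∀ q ∈ S2, ∃ γ : ℝ → Fin 3 → ℝ, γ 0 = q ∧ (∀ t, HasDerivAt γ (X (γ t)) t) ∧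
        ∀ t, γ t ∈ S2 := by
  let χ : ContDiffBump (0 : Fin 3 → ℝ) := ⟨2, 3, by norm_num, by norm_num⟩
  let v : (Fin 3 → ℝ) → (Fin 3 → ℝ) := fun p ↦ χ p • X p
  have hv : ContDiff ℝ 1 v := χ.contDiff.smul hX
  have hc : HasCompactSupport v := χ.hasCompactSupport.smul_right
  obtain ⟨K, hK⟩ := ContDiff.lipschitzWith_of_hasCompactSupport hc hv one_ne_zero
  obtain ⟨L, hL⟩ := hc.exists_bound_of_continuous hv.continuous
  have hvX : ∀ p ∈ S2, v p = X p := by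
    intro p hp
    have : χ p = 1 := by
      apply χ.one_of_mem_closedBall
      rw [mem_closedBall_zero_iff, pi_norm_le_iff_of_nonneg (by norm_num [χ])]
      have hp' : p 0 ^ 2 + p 1 ^ 2 + p 2 ^ 2 = 1 := hp
      intro i
      rw [Real.norm_eq_abs, abs_le]
      fin_cases i <;> simp [χ] <;> constructor <;> nlinarith [sq_nonneg (p 0), sq_nonneg (p 1), sq_nonneg (p 2)]
    simp [v, this]
  refine ⟨K, v, hK, hvX, fun q hq ↦ ?_⟩
  obtain ⟨γ, h0, hγ⟩ := exists_global_solution (L := L.toNNReal) hK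
    (fun x ↦ (hL x).trans (Real.le_coe_toNNReal L)) q
  have hS : ∀ t, γ t ∈ S2 := by
    have hd : ∀ t, HasDerivAt (fun s ↦ γ s 0 ^ 2 + γ s 1 ^ 2 + γ s 2 ^ 2) 0 t := by
      intro t
      have h := fun i ↦ hasDerivAt_pi.1 (hγ t) i
      refine ((((h 0).pow 2).add ((h 1).pow 2)).add ((h 2).pow 2)).congr_deriv ?_
      have := htan (γ t)
      simp only [dot3, v, Pi.smul_apply, smul_eq_mul] at this ⊢
      linear_combination 2 * χ (γ t) * this
    intro t
    have := is_const_of_deriv_eq_zero (fun s ↦ (hd s).differentiableAt) (fun s ↦ (hd s).deriv) t 0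
    simp only [h0] at this
    exact this.trans hq
  exact ⟨γ, h0, fun t ↦ hvX _ (hS t) ▸ hγ t, hS⟩

/-- Periodic nonconstant solutions of `X` on `S²`. -/
structure IsPeriodicSol (X : (Fin 3 → ℝ) → (Fin 3 → ℝ)) (γ : ℝ → Fin 3 → ℝ) (T : ℝ) : Prop where
  hasDerivAt : ∀ t, HasDerivAt γ (X (γ t)) t
  pos : 0 < T
  periodic : ∀ t, γ (t + T) = γ t
  nonconst : ¬ ∀ t, γ t = γ 0
  mem : ∀ t, γ t ∈ S2

theorem isPeriodicOrbitOn_iff {X : (Fin 3 → ℝ) → (Fin 3 → ℝ)} {Γ : Set (Fin 3 → ℝ)} :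
    IsPeriodicOrbitOn X Γ ↔ ∃ γ T, IsPeriodicSol X γ T ∧ Γ = range γ := by
  constructor
  · rintro ⟨γ, T, h1, h2, h3, h4, h5, h6⟩
    exact ⟨γ, T, ⟨h1, h2, h3, h4, fun t ↦ h5 ⟨t, rfl⟩⟩, h6⟩
  · rintro ⟨γ, T, ⟨h1, h2, h3, h4, h5⟩, h6⟩
    exact ⟨γ, T, h1, h2, h3, h4, range_subset_iff.2 h5, h6⟩

theorem dist_sphere_solutions_le {X : (Fin 3 → ℝ) → (Fin 3 → ℝ)} (hX : ContDiff ℝ 1 X)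
    (htan : ∀ p, dot3 p (X p) = 0) : ∃ K : ℝ≥0, ∀ α β : ℝ → Fin 3 → ℝ,
      (∀ t, HasDerivAt α (X (α t)) t) → (∀ t, α t ∈ S2) →
      (∀ t, HasDerivAt β (X (β t)) t) → (∀ t, β t ∈ S2) →
      ∀ t, 0 ≤ t → dist (α t) (β t) ≤ dist (α 0) (β 0) * Real.exp (K * t) := by
  obtain ⟨K, v, hK, hv, -⟩ := exists_lipschitz_extension_flow hX htan
  refine ⟨K, fun α β hα hαS hβ hβS t ht ↦ ?_⟩
  have := dist_le_of_trajectories_ODE (v := fun _ ↦ v) (K := K) (a := 0) (b := t) (f := α) (g := β)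
    (fun _ ↦ hK) (fun s _ ↦ (hα s).continuousAt.continuousWithinAt)
    (fun s _ ↦ by simpa only [hv _ (hαS s)] using (hα s).hasDerivWithinAt)
    (fun s _ ↦ (hβ s).continuousAt.continuousWithinAt)
    (fun s _ ↦ by simpa only [hv _ (hβS s)] using (hβ s).hasDerivWithinAt) le_rfl t ⟨ht, le_rfl⟩
  simpa using this

theorem sphere_solution_unique {X : (Fin 3 → ℝ) → (Fin 3 → ℝ)} (hX : ContDiff ℝ 1 X)
    (htan : ∀ p, dot3 p (X p) = 0) {α β : ℝ → Fin 3 → ℝ}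
    (hα : ∀ t, HasDerivAt α (X (α t)) t) (hαS : ∀ t, α t ∈ S2)
    (hβ : ∀ t, HasDerivAt β (X (β t)) t) (hβS : ∀ t, β t ∈ S2) {t₀ : ℝ} (h : α t₀ = β t₀) :
    α = β := by
  obtain ⟨K, v, hK, hv, -⟩ := exists_lipschitz_extension_flow hX htan
  exact ODE_solution_unique_univ (v := fun _ ↦ v) (s := fun _ ↦ univ) (K := K)
    (fun _ ↦ hK.lipschitzOnWith)
    (fun s ↦ ⟨by simpa only [hv _ (hαS s)] using hα s, trivial⟩)
    (fun s ↦ ⟨by simpa only [hv _ (hβS s)] using hβ s, trivial⟩) h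

theorem IsPeriodicSol.field_ne_zero {X : (Fin 3 → ℝ) → (Fin 3 → ℝ)} (hX : ContDiff ℝ 1 X)
    (htan : ∀ p, dot3 p (X p) = 0) {γ : ℝ → Fin 3 → ℝ} {T : ℝ} (h : IsPeriodicSol X γ T) (t : ℝ) :
    X (γ t) ≠ 0 := by
  intro h0
  refine h.nonconst fun s ↦ ?_
  have := sphere_solution_unique hX htan h.hasDerivAt h.mem (β := fun _ ↦ γ t)
    (fun s ↦ by simpa only [h0] using hasDerivAt_const s (γ t)) (fun _ ↦ h.mem t) (t₀ := t) rfl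
  rw [this]

/-- The reflection of `ℝ³` in the plane orthogonal to the unit vector `n`. -/
def reflect (n p : Fin 3 → ℝ) : Fin 3 → ℝ := fun i ↦ p i - 2 * dot3 n p * n i

theorem dot3_reflect {n : Fin 3 → ℝ} (hn : dot3 n n = 1) (p : Fin 3 → ℝ) :
    dot3 n (reflect n p) = - dot3 n p := by
  simp only [dot3, reflect] at *
  linear_combination (-2 * (n 0 * p 0 + n 1 * p 1 + n 2 * p 2)) * hn

theorem reflect_eq_self {n p : Fin 3 → ℝ} (h : dot3 n p = 0) : reflect n p = p := by
  ext i; simp [reflect, h]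

theorem reflect_mem_S2 {n : Fin 3 → ℝ} (hn : dot3 n n = 1) {p : Fin 3 → ℝ} (hp : p ∈ S2) :
    reflect n p ∈ S2 := by
  have hp' : p 0 ^ 2 + p 1 ^ 2 + p 2 ^ 2 = 1 := hp
  change reflect n p 0 ^ 2 + reflect n p 1 ^ 2 + reflect n p 2 ^ 2 = 1
  simp only [dot3, reflect] at *
  linear_combination hp' + 4 * (n 0 * p 0 + n 1 * p 1 + n 2 * p 2) ^ 2 * hn

theorem hasDerivAt_dot3 {γ : ℝ → Fin 3 → ℝ} {γ' : Fin 3 → ℝ} {t : ℝ} (h : HasDerivAt γ γ' t)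
    (n : Fin 3 → ℝ) : HasDerivAt (fun s ↦ dot3 n (γ s)) (dot3 n γ') t := by
  have h' := hasDerivAt_pi.1 h
  exact (((h' 0).const_mul _).add ((h' 1).const_mul _)).add ((h' 2).const_mul _)

theorem continuous_dot3 (n : Fin 3 → ℝ) : Continuous (dot3 n) := by
  unfold dot3; fun_prop

theorem hasDerivAt_reflect {γ : ℝ → Fin 3 → ℝ} {γ' : Fin 3 → ℝ} {t : ℝ} (h : HasDerivAt γ γ' t)
    (n : Fin 3 → ℝ) : HasDerivAt (fun s ↦ reflect n (γ s)) (reflect n γ') t := by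
  refine hasDerivAt_pi.2 fun i ↦ ?_
  exact (hasDerivAt_pi.1 h i).sub (((hasDerivAt_dot3 h n).const_mul 2).mul_const (n i))

section Reversible

variable {X : (Fin 3 → ℝ) → (Fin 3 → ℝ)} {n : Fin 3 → ℝ} {β : ℝ → Fin 3 → ℝ}

theorem reversible_solution_neg (hX : ContDiff ℝ 1 X) (htan : ∀ p, dot3 p (X p) = 0)
    (hn : dot3 n n = 1) (hrev : ∀ p, X (reflect n p) = - reflect n (X p))
    (hβ : ∀ t, HasDerivAt β (X (β t)) t) (hβS : ∀ t, β t ∈ S2) (h0 : dot3 n (β 0) = 0) (t : ℝ) :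
    reflect n (β (-t)) = β t := by
  have : (fun t ↦ reflect n (β (-t))) = β := by
    refine sphere_solution_unique hX htan (fun t ↦ ?_) (fun t ↦ reflect_mem_S2 hn (hβS _)) hβ hβS
      (t₀ := 0) (by simpa using reflect_eq_self h0)
    have h1 : HasDerivAt (fun s ↦ β (-s)) (-X (β (-t))) t := by
      have := (hβ (-t)).scomp t (hasDerivAt_neg t)
      rw [neg_one_smul] at this
      exact this
    refine (hasDerivAt_reflect h1 n).congr_deriv ?_
    rw [hrev]
    ext i
    simp [reflect, dot3]
    ring
  exact congrFun this t

theorem reversible_solution_periodic (hX : ContDiff ℝ 1 X) (htan : ∀ p, dot3 p (X p) = 0)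
    (hn : dot3 n n = 1) (hrev : ∀ p, X (reflect n p) = - reflect n (X p))
    (hβ : ∀ t, HasDerivAt β (X (β t)) t) (hβS : ∀ t, β t ∈ S2) (h0 : dot3 n (β 0) = 0) {s : ℝ}
    (hs : dot3 n (β s) = 0) (t : ℝ) : β (t + 2 * s) = β t := by
  have : (fun t ↦ β (t + 2 * s)) = β := by
    refine sphere_solution_unique hX htan (fun t ↦ (hβ _).comp_add_const t (2 * s))
      (fun t ↦ hβS _) hβ hβS (t₀ := -s) ?_
    have := reversible_solution_neg hX htan hn hrev hβ hβS h0 (-s)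
    rw [neg_neg, reflect_eq_self hs] at this
    rw [← this]
    congr 1
    ring
  exact congrFun this t

theorem reversible_dot3_field_ne_zero (hrev : ∀ p, X (reflect n p) = - reflect n (X p))
    {p : Fin 3 → ℝ} (hp : dot3 n p = 0) (h : X p ≠ 0) : dot3 n (X p) ≠ 0 := by
  intro h0
  have := hrev p
  rw [reflect_eq_self hp, reflect_eq_self h0] at this
  exact h (self_eq_neg.1 this)

end Reversible

theorem exists_mul_neg_of_hasDerivAt {h : ℝ → ℝ} {h' x ε : ℝ} (hd : HasDerivAt h h' x)
    (hx : h x = 0) (hne : h' ≠ 0) (hε : 0 < ε) :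
    ∃ s ∈ Ioo (x - ε) x, ∃ t ∈ Ioo x (x + ε), h s * h t < 0 := by
  have hs := (hasDerivAt_iff_tendsto_slope.1 hd).mul_const h'
  have hev : ∀ᶠ y in 𝓝[≠] x, 0 < slope h x y * h' :=
    hs.eventually (lt_mem_nhds (mul_self_pos.2 hne))
  have h1 : ∀ᶠ y in 𝓝[<] x, 0 < slope h x y * h' :=
    hev.filter_mono (nhdsWithin_mono _ fun y hy ↦ ne_of_lt hy)
  have h2 : ∀ᶠ y in 𝓝[>] x, 0 < slope h x y * h' :=
    hev.filter_mono (nhdsWithin_mono _ fun y hy ↦ ne_of_gt hy)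
  obtain ⟨s, hs, hs'⟩ := (h1.and (Ioo_mem_nhdsLT (sub_lt_self x hε))).exists
  obtain ⟨t, ht, ht'⟩ := (h2.and (Ioo_mem_nhdsGT (lt_add_of_pos_right x hε))).exists
  refine ⟨s, hs', t, ht', ?_⟩
  have es : h s = slope h x s * (s - x) := by
    have : s - x ≠ 0 := by linarith [hs'.2]
    rw [slope_def_field, hx]; field_simp; simp
  have et : h t = slope h x t * (t - x) := by
    have : t - x ≠ 0 := by linarith [ht'.1]
    rw [slope_def_field, hx]; field_simp; simp
  have h3 : 0 < slope h x s * slope h x t := by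
    have := mul_pos hs ht
    have h4 : 0 < h' * h' := mul_self_pos.2 hne
    by_contra hcon
    nlinarith
  have h5 : (s - x) * (t - x) < 0 := mul_neg_of_neg_of_pos (by linarith [hs'.2]) (by linarith [ht'.1])
  rw [es, et]
  nlinarith

theorem countable_zeros_of_deriv_ne_zero {h h' : ℝ → ℝ} (hd : ∀ t, HasDerivAt h (h' t) t)
    (hne : ∀ t, h t = 0 → h' t ≠ 0) : {t | h t = 0}.Countable := by
  have : DiscreteTopology {t | h t = 0} := by
    rw [discreteTopology_subtype_iff]
    intro x hx
    have := (hd x).eventually_ne (hne x hx) (c := 0)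
    rw [← empty_mem_iff_bot, mem_inf_principal]
    filter_upwards [this] with y hy hy'
    exact hy hy'
  exact (TopologicalSpace.separableSpace_iff_countable (α := {t | h t = 0})).1 inferInstance

theorem isCompact_range_of_periodic {γ : ℝ → Fin 3 → ℝ} {T : ℝ} (hc : Continuous γ) (hT : 0 < T)
    (hper : ∀ t, γ (t + T) = γ t) : IsCompact (range γ) := by
  have : range γ = γ '' Icc 0 (0 + T) := by
    rw [Function.Periodic.image_Icc (f := γ) (c := T) hper hT]
  rw [this]
  exact isCompact_Icc.image hc

/-- The great circle through `p` in the plane orthogonal to `n`. -/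
noncomputable def circleArc (n p : Fin 3 → ℝ) (θ : ℝ) : Fin 3 → ℝ :=
  Real.cos θ • p + Real.sin θ • (crossProduct n p)

theorem continuous_circleArc (n p : Fin 3 → ℝ) : Continuous (circleArc n p) := by
  unfold circleArc; fun_prop

theorem circleArc_zero (n p : Fin 3 → ℝ) : circleArc n p 0 = p := by simp [circleArc]

theorem dot3_circleArc {n p : Fin 3 → ℝ} (hp : dot3 n p = 0) (θ : ℝ) :
    dot3 n (circleArc n p θ) = 0 := by
  simp only [dot3, circleArc, cross_apply] at *
  simp
  linear_combination Real.cos θ * hp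

theorem circleArc_mem_S2 {n p : Fin 3 → ℝ} (hn : dot3 n n = 1) (hp : dot3 n p = 0) (hS : p ∈ S2)
    (θ : ℝ) : circleArc n p θ ∈ S2 := by
  have hp' : p 0 ^ 2 + p 1 ^ 2 + p 2 ^ 2 = 1 := hS
  change circleArc n p θ 0 ^ 2 + circleArc n p θ 1 ^ 2 + circleArc n p θ 2 ^ 2 = 1
  simp only [dot3, circleArc, cross_apply] at *
  simp
  linear_combination Real.sin_sq_add_cos_sq θ + Real.cos θ ^ 2 * hp' +
    Real.sin θ ^ 2 * ((p 0 ^ 2 + p 1 ^ 2 + p 2 ^ 2) * hn + hp' -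
      (n 0 * p 0 + n 1 * p 1 + n 2 * p 2) * hp)

theorem dot3_cross_circleArc {n p : Fin 3 → ℝ} (hn : dot3 n n = 1) (hp : dot3 n p = 0)
    (hS : p ∈ S2) (θ : ℝ) : dot3 (crossProduct n p) (circleArc n p θ) = Real.sin θ := by
  have hp' : p 0 ^ 2 + p 1 ^ 2 + p 2 ^ 2 = 1 := hS
  simp only [dot3, circleArc, cross_apply] at *
  simp
  linear_combination Real.sin θ * ((p 0 ^ 2 + p 1 ^ 2 + p 2 ^ 2) * hn + hp' -
      (n 0 * p 0 + n 1 * p 1 + n 2 * p 2) * hp)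

theorem IsPeriodicSol.comp_add_const {X : (Fin 3 → ℝ) → (Fin 3 → ℝ)} {γ : ℝ → Fin 3 → ℝ} {T : ℝ}
    (h : IsPeriodicSol X γ T) (s : ℝ) : IsPeriodicSol X (fun t ↦ γ (t + s)) T where
  hasDerivAt t := (h.hasDerivAt _).comp_add_const t s
  pos := h.pos
  periodic t := by rw [add_right_comm, h.periodic]
  nonconst hc := by
    refine h.nonconst fun t ↦ ?_
    have h1 := hc (t - s)
    have h2 := hc (0 - s)
    simp only [sub_add_cancel] at h1 h2
    rw [h1, h2]
  mem t := h.mem _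

/-- In a reversible field, a periodic orbit that meets the plane of symmetry is not a limit
cycle. -/
theorem IsPeriodicSol.not_isLimitCycleOn_of_reversible {X : (Fin 3 → ℝ) → (Fin 3 → ℝ)}
    (hX : ContDiff ℝ 1 X) (htan : ∀ p, dot3 p (X p) = 0) {n : Fin 3 → ℝ} (hn : dot3 n n = 1)
    (hrev : ∀ p, X (reflect n p) = - reflect n (X p)) {γ : ℝ → Fin 3 → ℝ} {T : ℝ}
    (hγ : IsPeriodicSol X γ T) (hcross : ∃ t, dot3 n (γ t) = 0) :
    ¬ IsLimitCycleOn X (range γ) := by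
  obtain ⟨t₀, ht₀⟩ := hcross
  set α : ℝ → Fin 3 → ℝ := fun t ↦ γ (t + t₀) with hαdef
  have hα : IsPeriodicSol X α T := hγ.comp_add_const t₀
  have hrange : range γ = range α := by
    ext p
    constructor
    · rintro ⟨t, rfl⟩; exact ⟨t - t₀, by simp [α]⟩
    · rintro ⟨t, rfl⟩; exact ⟨t + t₀, rfl⟩
  have hα0 : dot3 n (α 0) = 0 := by simpa [α] using ht₀
  rw [hrange]
  clear_value α
  clear hαdef hrange
  rintro ⟨-, U, hU, hΓU, hiso⟩
  have hαc : Continuous α := continuous_iff_continuousAt.2 fun t ↦ (hα.hasDerivAt t).continuousAt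
  set h : ℝ → ℝ := fun t ↦ dot3 n (α t) with hh
  have hd : ∀ t, HasDerivAt h (dot3 n (X (α t))) t := fun t ↦ hasDerivAt_dot3 (hα.hasDerivAt t) n
  have hne : ∀ t, h t = 0 → dot3 n (X (α t)) ≠ 0 := fun t ht ↦
    reversible_dot3_field_ne_zero hrev ht (hα.field_ne_zero hX htan t)
  have hT := hα.pos
  have hhalf : h (T / 2) = 0 := by
    have h1 := reversible_solution_neg hX htan hn hrev hα.hasDerivAt hα.mem hα0 (T / 2)
    have h2 : α (-(T / 2)) = α (T / 2) := by
      rw [← hα.periodic (-(T / 2))]; congr 1; ring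
    rw [h2] at h1
    have h3 := dot3_reflect hn (α (T / 2))
    rw [h1] at h3
    simp only [hh]; linarith
  obtain ⟨t₁, ht₁, t₂, ht₂, hlt⟩ := exists_mul_neg_of_hasDerivAt (hd _) hhalf (hne _ hhalf)
    (half_pos hT)
  obtain ⟨K, hK⟩ := dist_sphere_solutions_le hX htan
  obtain ⟨-, -, -, -, hflow⟩ := exists_lipschitz_extension_flow hX htan
  obtain ⟨ε, hε, hεU⟩ := (isCompact_range_of_periodic hαc hT hα.periodic).exists_thickening_subset_open
    hU hΓU
  have hev₁ : ∀ᶠ p in 𝓝 (α t₁), 0 < dot3 n p * h t₁ :=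
    ((continuous_dot3 n).mul continuous_const).continuousAt.eventually
      (lt_mem_nhds (mul_self_pos.2 (left_ne_zero_of_mul hlt.ne)))
  have hev₂ : ∀ᶠ p in 𝓝 (α t₂), 0 < dot3 n p * h t₂ :=
    ((continuous_dot3 n).mul continuous_const).continuousAt.eventually
      (lt_mem_nhds (mul_self_pos.2 (right_ne_zero_of_mul hlt.ne)))
  obtain ⟨ε₁, hε₁, hε₁'⟩ := Metric.eventually_nhds_iff.1 hev₁
  obtain ⟨ε₂, hε₂, hε₂'⟩ := Metric.eventually_nhds_iff.1 hev₂
  set M := Real.exp (K * (2 * T)) with hM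
  have hMpos : 0 < M := Real.exp_pos _
  have hX0 : ∀ᶠ p in 𝓝 (α 0), X p ≠ 0 :=
    hX.continuous.continuousAt.eventually_ne (hα.field_ne_zero hX htan 0)
  have hδ : ∀ᶠ p in 𝓝 (α 0), dist (α 0) p * M < min ε (min ε₁ ε₂) := by
    have : Tendsto (fun p ↦ dist (α 0) p * M) (𝓝 (α 0)) (𝓝 (dist (α 0) (α 0) * M)) :=
      ((continuous_const.dist continuous_id).mul continuous_const).continuousAt
    refine this.eventually (gt_mem_nhds ?_)
    rw [dist_self, zero_mul]
    exact lt_min hε (lt_min hε₁ hε₂)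
  have hmain : ∀ᶠ p in 𝓝 (α 0), p ∈ S2 → dot3 n p = 0 → p ∈ range α := by
    filter_upwards [hX0, hδ] with q hq0 hqδ hqS hqn
    obtain ⟨β, hβ0, hβ, hβS⟩ := hflow q hqS
    have hclose : ∀ t, 0 ≤ t → t ≤ 2 * T → dist (α t) (β t) < min ε (min ε₁ ε₂) := by
      intro t h0 h1
      refine ((hK α β hα.hasDerivAt hα.mem hβ hβS t h0).trans ?_).trans_lt hqδ
      rw [hβ0, hM]
      gcongr
    have hc1 := hclose t₁ (by linarith [ht₁.1]) (by linarith [ht₁.2])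
    have hc2 := hclose t₂ (by linarith [ht₂.1]) (by linarith [ht₂.2])
    have hs1 : 0 < dot3 n (β t₁) * h t₁ := hε₁' (by
      rw [dist_comm]; exact hc1.trans_le ((min_le_right _ _).trans (min_le_left _ _)))
    have hs2 : 0 < dot3 n (β t₂) * h t₂ := hε₂' (by
      rw [dist_comm]; exact hc2.trans_le ((min_le_right _ _).trans (min_le_right _ _)))
    have hsign : dot3 n (β t₁) * dot3 n (β t₂) < 0 := by
      have := mul_pos hs1 hs2
      by_contra hcon
      nlinarith
    have hβc : Continuous fun t ↦ dot3 n (β t) :=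
      continuous_iff_continuousAt.2 fun t ↦ (hasDerivAt_dot3 (hβ t) n).continuousAt
    obtain ⟨s, hs, hs0⟩ : ∃ s ∈ Icc t₁ t₂, dot3 n (β s) = 0 := by
      have hle : t₁ ≤ t₂ := by linarith [ht₁.2, ht₂.1]
      rcases mul_neg_iff.1 hsign with ⟨h1, h2⟩ | ⟨h1, h2⟩
      · exact intermediate_value_Icc' hle hβc.continuousOn ⟨h2.le, h1.le⟩
      · exact intermediate_value_Icc hle hβc.continuousOn ⟨h1.le, h2.le⟩
    have hspos : 0 < s := by linarith [hs.1, ht₁.1]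
    have hsT : s < T := by linarith [hs.2, ht₂.2]
    have hβper := reversible_solution_periodic hX htan hn hrev hβ hβS (by rwa [hβ0]) hs0
    have hβsol : IsPeriodicSol X β (2 * s) := by
      refine ⟨hβ, by linarith, hβper, fun hc ↦ hq0 ?_, hβS⟩
      have h1 := hβ 0
      rw [hβ0] at h1
      have h2 : HasDerivAt β 0 0 := by
        rw [show β = fun _ ↦ β 0 from funext hc]; exact hasDerivAt_const _ _
      exact h1.unique h2
    have hβU : range β ⊆ U := by
      refine subset_trans ?_ hεU
      have : range β = β '' Icc 0 (0 + 2 * s) := by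
        rw [Function.Periodic.image_Icc (f := β) (c := 2 * s) hβper (by linarith)]
      rw [this]
      rintro _ ⟨t, ht, rfl⟩
      rw [Metric.mem_thickening_iff]
      refine ⟨α t, mem_range_self t, ?_⟩
      rw [dist_comm]
      exact (hclose t ht.1 (by linarith [ht.2])).trans_le (min_le_left _ _)
    have := hiso (range β) (isPeriodicOrbitOn_iff.2 ⟨β, 2 * s, hβsol, rfl⟩) hβU
    rw [← this]
    exact ⟨0, hβ0⟩
  have harc : ∀ᶠ θ in 𝓝 (0 : ℝ), circleArc n (α 0) θ ∈ range α := by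
    have := (continuous_circleArc n (α 0)).tendsto 0
    rw [circleArc_zero] at this
    filter_upwards [this.eventually hmain] with θ hθ
    exact hθ (circleArc_mem_S2 hn hα0 (hα.mem 0) θ) (dot3_circleArc hα0 θ)
  obtain ⟨η, hη, hη'⟩ := Metric.eventually_nhds_iff.1 harc
  have hcount : (Ioo (-(min η 1)) (min η 1)).Countable := by
    have hZ := (countable_zeros_of_deriv_ne_zero hd hne).image α
    refine MapsTo.countable_of_injOn (f := circleArc n (α 0)) (t := α '' {t | h t = 0}) ?_ ?_ hZ
    · intro θ hθ
      obtain ⟨t, ht⟩ := hη' (y := θ) (by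
        rw [Real.dist_eq, sub_zero, abs_lt]
        exact ⟨by linarith [hθ.1, min_le_left η 1], by linarith [hθ.2, min_le_left η 1]⟩)
      refine ⟨t, ?_, ht⟩
      change dot3 n (α t) = 0
      rw [ht, dot3_circleArc hα0]
    · intro θ hθ φ hφ heq
      have h1 := congrArg (dot3 (crossProduct n (α 0))) heq
      rw [dot3_cross_circleArc hn hα0 (hα.mem 0), dot3_cross_circleArc hn hα0 (hα.mem 0)] at h1
      have hpi := Real.pi_gt_three
      have h3 := min_le_right η 1
      exact Real.injOn_sin ⟨by linarith [hθ.1], by linarith [hθ.2]⟩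
        ⟨by linarith [hφ.1], by linarith [hφ.2]⟩ h1
  rw [Cardinal.Real.Ioo_countable_iff] at hcount
  have : 0 < min η 1 := lt_min hη one_pos
  linarith

section PeriodicReal

variable {h h' : ℝ → ℝ} {T : ℝ}

theorem exists_eq_zero_of_periodic (hd : ∀ t, HasDerivAt h (h' t) t) (hT : 0 < T)
    (hper : ∀ t, h (t + T) = h t) : ∃ t, h' t = 0 := by
  obtain ⟨c, -, hc⟩ := exists_hasDerivAt_eq_zero hT
    (fun t _ ↦ (hd t).continuousAt.continuousWithinAt) (by rw [← hper 0, zero_add])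
    (fun t _ ↦ hd t)
  exact ⟨c, hc⟩

theorem deriv_eq_zero_of_periodic_of_nonneg (hd : ∀ t, HasDerivAt h (h' t) t) (hT : 0 < T)
    (hper : ∀ t, h (t + T) = h t) (hnn : ∀ t, 0 ≤ h' t) (t : ℝ) : h' t = 0 := by
  have hmono : Monotone h := monotone_of_hasDerivAt_nonneg hd hnn
  have hconst : ∀ x y, x ≤ y → h x = h y := fun x y hxy ↦ by
    refine le_antisymm (hmono hxy) ?_
    obtain ⟨n, hn⟩ := Archimedean.arch (y - x) hT
    have hp : h (x + n • T) = h x := Function.Periodic.nsmul (f := h) (c := T) hper n x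
    rw [← hp]
    exact hmono (by linarith)
  have : h = fun _ ↦ h 0 := by
    funext s
    rcases le_total s 0 with hs | hs
    · exact hconst _ _ hs
    · exact (hconst _ _ hs).symm
  have h0 : HasDerivAt h 0 t := by rw [this]; exact hasDerivAt_const _ _
  exact (hd t).unique h0

theorem deriv_eq_zero_of_periodic_of_nonpos (hd : ∀ t, HasDerivAt h (h' t) t) (hT : 0 < T)
    (hper : ∀ t, h (t + T) = h t) (hnp : ∀ t, h' t ≤ 0) (t : ℝ) : h' t = 0 :=
  neg_eq_zero.1 (deriv_eq_zero_of_periodic_of_nonneg (h := fun t ↦ -h t) (h' := fun t ↦ -h' t)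
    (fun t ↦ (hd t).neg) hT (fun t ↦ by rw [hper]) (fun t ↦ neg_nonneg.2 (hnp t)) t)

theorem ne_zero_of_periodic_of_deriv_pos (hd : ∀ t, HasDerivAt h (h' t) t) (hT : 0 < T)
    (hper : ∀ t, h (t + T) = h t) (hpos : ∀ t, h t = 0 → 0 < h' t) (t : ℝ) : h t ≠ 0 := by
  intro h0
  have hge : ∀ s ∈ Icc t (t + T), -h s ≤ 0 :=
    image_le_of_deriv_right_lt_deriv_boundary (f := fun s ↦ -h s) (f' := fun s ↦ -h' s)
      (B := fun _ ↦ 0) (B' := fun _ ↦ 0)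
      (fun s _ ↦ (hd s).neg.continuousAt.continuousWithinAt)
      (fun s _ ↦ (hd s).neg.hasDerivWithinAt) (by simp [h0])
      (fun s ↦ hasDerivAt_const s 0) (fun s _ hs ↦ neg_lt_zero.2 (hpos s (neg_eq_zero.1 hs)))
  have hall : ∀ s, 0 ≤ h s := fun s ↦ by
    obtain ⟨y, hy, hys⟩ := Function.Periodic.exists_mem_Ico (f := h) (c := T) hper hT s t
    rw [hys]
    exact neg_nonpos.1 (hge y ⟨hy.1, hy.2.le⟩)
  have hmin : IsLocalMin h t := Eventually.of_forall fun s ↦ by rw [h0]; exact hall s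
  exact (hpos t h0).ne' (hmin.hasDerivAt_eq_zero (hd t))

theorem ne_zero_of_periodic_of_deriv_neg (hd : ∀ t, HasDerivAt h (h' t) t) (hT : 0 < T)
    (hper : ∀ t, h (t + T) = h t) (hneg : ∀ t, h t = 0 → h' t < 0) (t : ℝ) : h t ≠ 0 :=
  neg_ne_zero.1 (ne_zero_of_periodic_of_deriv_pos (h := fun t ↦ -h t) (h' := fun t ↦ -h' t)
    (fun t ↦ (hd t).neg) hT (fun t ↦ by rw [hper])
    (fun t ht ↦ neg_pos.2 (hneg t (neg_eq_zero.1 ht))) t)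

theorem pos_or_neg_of_ne_zero (hc : Continuous h) (hne : ∀ t, h t ≠ 0) :
    (∀ t, 0 < h t) ∨ ∀ t, h t < 0 := by
  by_contra! hcon
  obtain ⟨⟨s, hs⟩, t, ht⟩ := hcon
  obtain ⟨r, hr⟩ := mem_range_of_exists_le_of_exists_ge hc ⟨s, hs⟩ ⟨t, ht⟩
  exact hne r hr

/-- A solution of a scalar linear equation vanishes identically or nowhere. -/
theorem eq_zero_of_hasDerivAt_mul {g : ℝ → ℝ} (hd : ∀ t, HasDerivAt h (g t * h t) t)
    (hg : Continuous g) {t₀ : ℝ} (h0 : h t₀ = 0) (t : ℝ) : h t = 0 := by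
  set I : ℝ → ℝ := fun t ↦ ∫ s in t₀..t, g s
  have hI : ∀ t, HasDerivAt I (g t) t := fun t ↦ hg.integral_hasStrictDerivAt t₀ t |>.hasDerivAt
  have hk : ∀ t, HasDerivAt (fun s ↦ h s * Real.exp (-I s)) 0 t := fun t ↦ by
    refine ((hd t).mul (hI t).neg.exp).congr_deriv ?_
    ring
  have := is_const_of_deriv_eq_zero (fun t ↦ (hk t).differentiableAt) (fun t ↦ (hk t).deriv) t t₀
  simp only [h0, zero_mul] at this
  exact (mul_eq_zero.1 this).resolve_right (Real.exp_ne_zero _)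

end PeriodicReal

/-- The quadratic field `p ↦ p × M p` on the sphere, where the third column of `M` vanishes. -/
def crossField (a b c d e f : ℝ) (p : Fin 3 → ℝ) : Fin 3 → ℝ :=
  ![p 1 * (e * p 0 + f * p 1) - p 2 * (c * p 0 + d * p 1),
    p 2 * (a * p 0 + b * p 1) - p 0 * (e * p 0 + f * p 1),
    p 0 * (c * p 0 + d * p 1) - p 1 * (a * p 0 + b * p 1)]

theorem contDiff_crossField (a b c d e f : ℝ) : ContDiff ℝ 1 (crossField a b c d e f) := by
  refine contDiff_pi.2 fun i ↦ ?_
  fin_cases i <;> simp only [crossField] <;> simp <;> fun_prop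

theorem dot3_crossField (a b c d e f : ℝ) (p : Fin 3 → ℝ) :
    dot3 p (crossField a b c d e f p) = 0 := by
  simp [dot3, crossField]
  ring

section CrossField

variable {a b c d e f T : ℝ} {γ : ℝ → Fin 3 → ℝ}

theorem IsPeriodicSol.hasDerivAt_coord (h : IsPeriodicSol (crossField a b c d e f) γ T) (t : ℝ) :
    HasDerivAt (fun s ↦ γ s 0)
      (γ t 1 * (e * γ t 0 + f * γ t 1) - γ t 2 * (c * γ t 0 + d * γ t 1)) t ∧
    HasDerivAt (fun s ↦ γ s 1)
      (γ t 2 * (a * γ t 0 + b * γ t 1) - γ t 0 * (e * γ t 0 + f * γ t 1)) t ∧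
    HasDerivAt (fun s ↦ γ s 2)
      (γ t 0 * (c * γ t 0 + d * γ t 1) - γ t 1 * (a * γ t 0 + b * γ t 1)) t := by
  have := hasDerivAt_pi.1 (h.hasDerivAt t)
  exact ⟨this 0, this 1, this 2⟩

theorem IsPeriodicSol.coord_not_all_zero (h : IsPeriodicSol (crossField a b c d e f) γ T) (t : ℝ)
    (h0 : γ t 1 * (e * γ t 0 + f * γ t 1) - γ t 2 * (c * γ t 0 + d * γ t 1) = 0)
    (h1 : γ t 2 * (a * γ t 0 + b * γ t 1) - γ t 0 * (e * γ t 0 + f * γ t 1) = 0)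
    (h2 : γ t 0 * (c * γ t 0 + d * γ t 1) - γ t 1 * (a * γ t 0 + b * γ t 1) = 0) : False := by
  refine h.field_ne_zero (contDiff_crossField ..) (dot3_crossField a b c d e f) t ?_
  ext i
  fin_cases i
  exacts [h0, h1, h2]

theorem IsPeriodicSol.sum_sq (h : IsPeriodicSol (crossField a b c d e f) γ T) (t : ℝ) :
    γ t 0 ^ 2 + γ t 1 ^ 2 + γ t 2 ^ 2 = 1 := h.mem t

theorem IsPeriodicSol.comp_neg {X : (Fin 3 → ℝ) → Fin 3 → ℝ} (h : IsPeriodicSol X γ T) :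
    IsPeriodicSol (fun p ↦ -X p) (fun t ↦ γ (-t)) T where
  hasDerivAt t := by
    have := (h.hasDerivAt (-t)).scomp t (hasDerivAt_neg t)
    simpa [Function.comp_def] using this
  pos := h.pos
  periodic t := by rw [← h.periodic]; congr 1; ring
  nonconst hc := h.nonconst fun t ↦ by simpa using hc (-t)
  mem t := h.mem _

theorem IsPeriodicSol.crossField_comp_neg (h : IsPeriodicSol (crossField a b c d e f) γ T) :
    IsPeriodicSol (crossField (-a) (-b) (-c) (-d) (-e) (-f)) (fun t ↦ γ (-t)) T := by
  convert h.comp_neg using 1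
  funext p i
  fin_cases i <;> simp [crossField] <;> ring

theorem IsPeriodicSol.crossField_antipodal (h : IsPeriodicSol (crossField a b c d e f) γ T) :
    IsPeriodicSol (crossField a b c d e f) (fun t ↦ -γ (-t)) T where
  hasDerivAt t := by
    refine (h.comp_neg.hasDerivAt t).neg.congr_deriv ?_
    funext i
    fin_cases i <;> simp [crossField] <;> ring
  pos := h.pos
  periodic t := by rw [h.comp_neg.periodic t]
  nonconst hc := h.comp_neg.nonconst fun t ↦ neg_injective (hc t)
  mem t := by
    have := h.mem (-t)
    simpa [S2] using this

end CrossField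

section DegenerateField

variable {a c e f T : ℝ} {γ : ℝ → Fin 3 → ℝ}

theorem hasDerivAt_ratio (h : IsPeriodicSol (crossField a 0 c 0 e f) γ T)
    (hx : ∀ t, 0 < γ t 0) (t : ℝ) : HasDerivAt (fun s ↦ γ s 1 / γ s 0)
      ((a + c * (γ t 1 / γ t 0)) * γ t 2 -
        (e + f * (γ t 1 / γ t 0)) * (γ t 0 * (1 + (γ t 1 / γ t 0) ^ 2))) t := by
  obtain ⟨h0, h1, -⟩ := h.hasDerivAt_coord t
  refine (h1.div h0 (hx t).ne').congr_deriv ?_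
  have := (hx t).ne'
  field_simp
  ring

theorem not_isPeriodicSol_of_zero_zero (h : IsPeriodicSol (crossField 0 0 0 0 e f) γ T)
    (hf : f ≠ 0) (hx : ∀ t, 0 < γ t 0) : False := by
  have hd : ∀ t, HasDerivAt (fun s ↦ f * (e + f * (γ s 1 / γ s 0)) ^ 2) _ t := fun t ↦
    ((((hasDerivAt_ratio h hx t).const_mul f).const_add e).pow 2).const_mul f
  have hnp := fun t ↦ deriv_eq_zero_of_periodic_of_nonpos hd h.pos
    (fun t ↦ by rw [h.periodic]) (fun t ↦ by
      have := hx t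
      have h2 : 0 ≤ 2 * f ^ 2 * (e + f * (γ t 1 / γ t 0)) ^ 2 *
        (γ t 0 * (1 + (γ t 1 / γ t 0) ^ 2)) := by positivity
      simp
      linarith) t
  refine h.coord_not_all_zero 0 ?_ ?_ (by ring)
  all_goals
    have h0 := hnp 0
    have hx0 := hx 0
    have hp : 0 < γ 0 0 * (1 + (γ 0 1 / γ 0 0) ^ 2) := by positivity
    have hl : e + f * (γ 0 1 / γ 0 0) = 0 := by
      have hq : 1 + (γ 0 1 / γ 0 0) ^ 2 ≠ 0 := by positivity
      simpa [hf, hx0.ne', hq] using h0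
    have : e * γ 0 0 + f * γ 0 1 = 0 := by field_simp at hl; linarith
    rw [this]; ring

/-- The equilibrium height of the ratio equation at ratio `u`. -/
noncomputable def ratioHeight (a c e f u : ℝ) : ℝ :=
  (e + f * u) * √(1 + u ^ 2) / √((a + c * u) ^ 2 + ((e + f * u) * √(1 + u ^ 2)) ^ 2)

theorem continuousOn_ratioHeight (a c e f : ℝ) :
    ContinuousOn (ratioHeight a c e f) {u | 0 < a + c * u} := by
  unfold ratioHeight
  refine ContinuousOn.div (by fun_prop) (by fun_prop) fun u hu ↦ ?_
  have hu' : 0 < a + c * u := hu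
  positivity

theorem exists_primitive_ratioHeight (a c e f u₀ : ℝ) (h₀ : 0 < a + c * u₀) : ∃ F : ℝ → ℝ,
    ∀ u, 0 < a + c * u → HasDerivAt F (ratioHeight a c e f u) u := by
  refine ⟨fun u ↦ ∫ s in u₀..u, ratioHeight a c e f s, fun u hu ↦ ?_⟩
  have hopen : IsOpen {u | 0 < a + c * u} := isOpen_lt continuous_const (by fun_prop)
  have hcont := continuousOn_ratioHeight a c e f
  refine intervalIntegral.integral_hasDerivAt_right ?_ ?_ (hcont.continuousAt (hopen.mem_nhds hu))
  · refine (hcont.mono fun s hs ↦ ?_).intervalIntegrable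
    have hconv : Convex ℝ {u : ℝ | 0 < a + c * u} := by
      intro x hx y hy s t hs ht hst
      have hx' : 0 < a + c * x := hx
      have hy' : 0 < a + c * y := hy
      change 0 < a + c * (s * x + t * y)
      rw [show a + c * (s * x + t * y) = s * (a + c * x) + t * (a + c * y) by
        linear_combination (-a) * hst]
      rcases hs.eq_or_lt with rfl | hs
      · rw [zero_add] at hst; subst hst; linarith
      · positivity
    exact hconv.ordConnected.uIcc_subset h₀ hu hs
  · exact hcont.stronglyMeasurableAtFilter hopen u hu

theorem height_sub_mul_nonneg {w z w₀ z₀ : ℝ} (h : w ^ 2 + z ^ 2 = 1) (h₀ : w₀ ^ 2 + z₀ ^ 2 = 1)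
    (hw : 0 < w) (hw₀ : 0 < w₀) : 0 ≤ (w₀ * z - z₀ * w) * (z - z₀) ∧
      ((w₀ * z - z₀ * w) * (z - z₀) = 0 → w₀ * z - z₀ * w = 0) := by
  have hk : 0 < 1 + (w₀ * w + z₀ * z) := by nlinarith [sq_nonneg (z + z₀), mul_pos hw hw₀]
  have key : (1 + (w₀ * w + z₀ * z)) * (z - z₀) = (w₀ * z - z₀ * w) * (w + w₀) := by
    linear_combination z₀ * h - z * h₀
  have key' : (1 + (w₀ * w + z₀ * z)) * ((w₀ * z - z₀ * w) * (z - z₀)) =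
      (w₀ * z - z₀ * w) ^ 2 * (w + w₀) := by linear_combination (w₀ * z - z₀ * w) * key
  constructor
  · have : 0 ≤ (w₀ * z - z₀ * w) ^ 2 * (w + w₀) := by positivity
    rw [← key'] at this
    exact nonneg_of_mul_nonneg_right this hk
  · intro h0
    rw [h0, mul_zero] at key'
    have := mul_eq_zero.1 key'.symm
    simpa [(add_pos hw hw₀).ne'] using this

theorem not_isPeriodicSol_of_pos_pos (h : IsPeriodicSol (crossField a 0 c 0 e f) γ T)
    (hf : f ≠ 0) (hx : ∀ t, 0 < γ t 0) (hg : ∀ t, 0 < a * γ t 0 + c * γ t 1) : False := by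
  have hg' : ∀ t, 0 < a + c * (γ t 1 / γ t 0) := fun t ↦ by
    have h2 := (hx t).ne'
    rw [show a + c * (γ t 1 / γ t 0) = (a * γ t 0 + c * γ t 1) / γ t 0 by field_simp]
    exact div_pos (hg t) (hx t)
  obtain ⟨F, hF⟩ := exists_primitive_ratioHeight a c e f _ (hg' 0)
  have hdu := hasDerivAt_ratio h hx
  have hd : ∀ t, HasDerivAt (fun s ↦ f * (a * γ s 0 + c * γ s 1 +
      (e + f * (γ s 1 / γ s 0)) * γ s 2 - f * F (γ s 1 / γ s 0)))
      (f ^ 2 * (((a + c * (γ t 1 / γ t 0)) * γ t 2 -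
        (e + f * (γ t 1 / γ t 0)) * (γ t 0 * (1 + (γ t 1 / γ t 0) ^ 2))) *
        (γ t 2 - ratioHeight a c e f (γ t 1 / γ t 0)))) t := by
    intro t
    obtain ⟨h0, h1, h2⟩ := h.hasDerivAt_coord t
    refine (((((h0.const_mul a).add (h1.const_mul c)).add
      ((((hdu t).const_mul f).const_add e).mul h2)).sub
      (((hF _ (hg' t)).comp t (hdu t)).const_mul f)).const_mul f).congr_deriv ?_
    have := (hx t).ne'
    field_simp
    ring
  have hsign : ∀ t, ∃ ρ > 0, ∃ s : ℝ, ((a + c * (γ t 1 / γ t 0)) * γ t 2 -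
        (e + f * (γ t 1 / γ t 0)) * (γ t 0 * (1 + (γ t 1 / γ t 0) ^ 2))) = ρ * s ∧
      0 ≤ s * (γ t 2 - ratioHeight a c e f (γ t 1 / γ t 0)) ∧
      (s * (γ t 2 - ratioHeight a c e f (γ t 1 / γ t 0)) = 0 → s = 0) := by
    intro t
    have hxt := hx t
    have hgt := hg' t
    have hsum := h.sum_sq t
    obtain ⟨u, hu⟩ : ∃ u, u = γ t 1 / γ t 0 := ⟨_, rfl⟩
    have hy : γ t 1 = u * γ t 0 := by rw [hu]; field_simp
    rw [← hu] at hgt ⊢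
    rw [hy] at hsum
    have hq : √(1 + u ^ 2) ^ 2 = 1 + u ^ 2 := Real.sq_sqrt (by positivity)
    have hqpos : 0 < √(1 + u ^ 2) := by positivity
    set q := √(1 + u ^ 2)
    have hρ : √((a + c * u) ^ 2 + ((e + f * u) * q) ^ 2) ^ 2 =
      (a + c * u) ^ 2 + ((e + f * u) * q) ^ 2 := Real.sq_sqrt (by positivity)
    have hρpos : 0 < √((a + c * u) ^ 2 + ((e + f * u) * q) ^ 2) := by positivity
    have hz : ratioHeight a c e f u = (e + f * u) * q /
      √((a + c * u) ^ 2 + ((e + f * u) * q) ^ 2) := rfl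
    rw [hz]
    set ρ := √((a + c * u) ^ 2 + ((e + f * u) * q) ^ 2)
    refine ⟨ρ, hρpos, (a + c * u) / ρ * γ t 2 - (e + f * u) * q / ρ * (γ t 0 * q), ?_,
      height_sub_mul_nonneg ?_ ?_ (mul_pos hxt hqpos) (div_pos hgt hρpos)⟩
    · field_simp
      rw [hq]
    · rw [mul_pow, hq]; linarith
    · field_simp
      linarith
  have hnn := deriv_eq_zero_of_periodic_of_nonneg hd h.pos
    (fun t ↦ by simp only [h.periodic]) fun t ↦ by
      obtain ⟨ρ, hρ, s, hs, hs1, -⟩ := hsign t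
      rw [hs, mul_assoc ρ]
      positivity
  have hu : ∀ t, ((a + c * (γ t 1 / γ t 0)) * γ t 2 -
        (e + f * (γ t 1 / γ t 0)) * (γ t 0 * (1 + (γ t 1 / γ t 0) ^ 2))) = 0 := by
    intro t
    obtain ⟨ρ, hρ, s, hs, -, hs2⟩ := hsign t
    have h0 := hnn t
    rw [hs, mul_assoc ρ] at h0
    rw [hs, hs2 (by simpa [hf, hρ.ne'] using h0), mul_zero]
  obtain ⟨t, ht⟩ := exists_eq_zero_of_periodic (fun t ↦ (h.hasDerivAt_coord t).2.2) h.pos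
    (fun t ↦ by rw [h.periodic])
  have hut := hu t
  have hxt := hx t
  have hgt := hg t
  have hz : c * γ t 0 - a * γ t 1 = 0 := by
    have : γ t 0 * (c * γ t 0 - a * γ t 1) = 0 := by linarith
    exact (mul_eq_zero.1 this).resolve_left hxt.ne'
  field_simp at hut
  have hr : 0 < γ t 0 ^ 2 + γ t 1 ^ 2 := by positivity
  have e1 : γ t 1 * (e * γ t 0 + f * γ t 1) - γ t 2 * (c * γ t 0) = 0 := by
    refine (mul_eq_zero.1 (?_ : (γ t 0 ^ 2 + γ t 1 ^ 2) * _ = 0)).resolve_left hr.ne'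
    linear_combination (-γ t 1) * hut - γ t 0 ^ 2 * γ t 2 * hz
  have e2 : γ t 2 * (a * γ t 0) - γ t 0 * (e * γ t 0 + f * γ t 1) = 0 := by
    refine (mul_eq_zero.1 (?_ : (γ t 0 ^ 2 + γ t 1 ^ 2) * _ = 0)).resolve_left hr.ne'
    linear_combination (γ t 0) * hut - γ t 0 * γ t 1 * γ t 2 * hz
  exact h.coord_not_all_zero t (by linarith) (by linarith) (by linarith)

theorem not_isPeriodicSol_of_pos (h : IsPeriodicSol (crossField a 0 c 0 e f) γ T)
    (hf : f ≠ 0) (hx : ∀ t, 0 < γ t 0) : False := by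
  by_cases hac : a = 0 ∧ c = 0
  · obtain ⟨rfl, rfl⟩ := hac
    exact not_isPeriodicSol_of_zero_zero h hf hx
  have hac' : 0 < a ^ 2 + c ^ 2 := by
    by_contra hcon
    exact hac ⟨by nlinarith, by nlinarith⟩
  have hd : ∀ t, HasDerivAt (fun s ↦ a * γ s 0 + c * γ s 1)
      ((e * γ t 0 + f * γ t 1) * (a * γ t 1 - c * γ t 0)) t := fun t ↦ by
    obtain ⟨h0, h1, -⟩ := h.hasDerivAt_coord t
    refine ((h0.const_mul a).add (h1.const_mul c)).congr_deriv ?_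
    ring
  have hcont : ∀ i, Continuous fun t ↦ γ t i := fun i ↦ continuous_iff_continuousAt.2 fun t ↦
    (hasDerivAt_pi.1 (h.hasDerivAt t) i).continuousAt
  have hper : ∀ t, a * γ (t + T) 0 + c * γ (t + T) 1 = a * γ t 0 + c * γ t 1 := fun t ↦ by
    rw [h.periodic]
  have hne : ∀ t, a * γ t 0 + c * γ t 1 ≠ 0 := by
    by_cases hβ : e * c - f * a = 0
    · intro t₀ ht₀
      have hc : c ≠ 0 := by
        rintro rfl
        have : a = 0 := by simpa [hf] using hβ
        simp [this] at hac'
      have hlin : ∀ x y, e * x + f * y = f / c * (a * x + c * y) := fun x y ↦ by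
        field_simp
        linear_combination x * hβ
      have hz := eq_zero_of_hasDerivAt_mul (h := fun t ↦ a * γ t 0 + c * γ t 1)
        (g := fun t ↦ f / c * (a * γ t 1 - c * γ t 0))
        (fun t ↦ (hd t).congr_deriv (by rw [hlin]; ring))
        (by have := hcont 0; have := hcont 1; fun_prop) ht₀
      obtain ⟨t, ht⟩ := exists_eq_zero_of_periodic (fun t ↦ (h.hasDerivAt_coord t).2.2) h.pos
        (fun t ↦ by rw [h.periodic])
      have hzt : a * γ t 0 + c * γ t 1 = 0 := hz t
      have hxt := hx t
      have : γ t 0 ^ 2 * (a ^ 2 + c ^ 2) = 0 := by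
        linear_combination c * ht + γ t 0 * a * hzt
      have hp : 0 < γ t 0 ^ 2 * (a ^ 2 + c ^ 2) := by positivity
      exact hp.ne' this
    · have hzero : ∀ t, a * γ t 0 + c * γ t 1 = 0 → ∃ k > 0,
          (e * γ t 0 + f * γ t 1) * (a * γ t 1 - c * γ t 0) = -(k * (e * c - f * a)) := by
        intro t ht
        have hxt := hx t
        refine ⟨(γ t 0 ^ 2 + γ t 1 ^ 2), by positivity, ?_⟩
        linear_combination (e * γ t 1 - f * γ t 0) * ht
      rcases lt_or_gt_of_ne hβ with hβ | hβ
      · refine ne_zero_of_periodic_of_deriv_pos hd h.pos hper fun t ht ↦ ?_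
        obtain ⟨k, hk, heq⟩ := hzero t ht
        rw [heq]; nlinarith
      · refine ne_zero_of_periodic_of_deriv_neg hd h.pos hper fun t ht ↦ ?_
        obtain ⟨k, hk, heq⟩ := hzero t ht
        rw [heq]; nlinarith
  rcases pos_or_neg_of_ne_zero (by have := hcont 0; have := hcont 1; fun_prop) hne with hg | hg
  · exact not_isPeriodicSol_of_pos_pos h hf hx hg
  · have h' := h.crossField_comp_neg
    rw [neg_zero] at h'
    refine not_isPeriodicSol_of_pos_pos h' (neg_ne_zero.2 hf) (fun t ↦ hx _) fun t ↦ ?_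
    linarith [hg (-t)]

theorem not_isPeriodicSol_crossField_of_ne_zero
    (h : IsPeriodicSol (crossField a 0 c 0 e f) γ T) (hf : f ≠ 0) : False := by
  have hd := fun t ↦ (h.hasDerivAt_coord t).1
  have hper : ∀ t, γ (t + T) 0 = γ t 0 := fun t ↦ by rw [h.periodic]
  have hsq : ∀ t, γ t 0 = 0 → 0 < γ t 1 ^ 2 := fun t ht ↦ by
    rw [sq_pos_iff]
    intro h1
    exact h.coord_not_all_zero t (by rw [ht, h1]; ring) (by rw [ht]; ring) (by rw [ht, h1]; ring)
  have hne : ∀ t, γ t 0 ≠ 0 := by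
    rcases lt_or_gt_of_ne hf with hf | hf
    · refine ne_zero_of_periodic_of_deriv_neg hd h.pos hper fun t ht ↦ ?_
      rw [ht]
      nlinarith [hsq t ht]
    · refine ne_zero_of_periodic_of_deriv_pos hd h.pos hper fun t ht ↦ ?_
      rw [ht]
      nlinarith [hsq t ht]
  rcases pos_or_neg_of_ne_zero (continuous_iff_continuousAt.2 fun t ↦ (hd t).continuousAt) hne
    with hx | hx
  · exact not_isPeriodicSol_of_pos h hf hx
  · exact not_isPeriodicSol_of_pos h.crossField_antipodal hf fun t ↦ by simpa using hx (-t)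

theorem reflect_apply (n p : Fin 3 → ℝ) (i : Fin 3) :
    reflect n p i = p i - 2 * dot3 n p * n i := rfl

theorem not_isLimitCycleOn_of_zero (h : IsPeriodicSol (crossField a 0 c 0 e 0) γ T) :
    ¬ IsLimitCycleOn (crossField a 0 c 0 e 0) (range γ) := by
  by_cases hce : c ^ 2 + e ^ 2 = 0
  · have hc : c = 0 := by nlinarith [sq_nonneg c, sq_nonneg e]
    have he : e = 0 := by nlinarith [sq_nonneg c, sq_nonneg e]
    subst hc he
    refine h.not_isLimitCycleOn_of_reversible (n := ![0, 1, 0]) (contDiff_crossField ..)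
      (dot3_crossField _ _ _ _ _ _) (by simp [dot3]) (fun p ↦ ?_) ?_
    · funext i
      fin_cases i <;> simp [crossField, reflect_apply, dot3] <;> ring
    · obtain ⟨t, ht⟩ := exists_eq_zero_of_periodic (fun t ↦ (h.hasDerivAt_coord t).2.2) h.pos
        (fun t ↦ by rw [h.periodic])
      refine ⟨t, ?_⟩
      by_contra hcon
      have h1 : γ t 1 ≠ 0 := by simpa [dot3] using hcon
      have h2 : a * γ t 0 = 0 := (mul_eq_zero.1 (by linarith : γ t 1 * (a * γ t 0) = 0)).resolve_left h1
      exact h.coord_not_all_zero t (by ring) (by linear_combination γ t 2 * h2)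
        (by linear_combination -γ t 1 * h2)
  · have hpos : 0 < c ^ 2 + e ^ 2 := lt_of_le_of_ne (by positivity) (Ne.symm hce)
    have hs : √(c ^ 2 + e ^ 2) ^ 2 = c ^ 2 + e ^ 2 := Real.sq_sqrt hpos.le
    have hspos : 0 < √(c ^ 2 + e ^ 2) := by positivity
    set s := √(c ^ 2 + e ^ 2)
    obtain ⟨v, hv⟩ : ∃ v, v = e / s := ⟨_, rfl⟩
    obtain ⟨w, hw⟩ : ∃ w, w = c / s := ⟨_, rfl⟩
    have hes : e = s * v := by rw [hv]; field_simp
    have hcs : c = s * w := by rw [hw]; field_simp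
    have hvw : v ^ 2 + w ^ 2 = 1 := by
      rw [hv, hw]; field_simp; linarith
    clear_value s
    clear hv hw hs
    subst hes hcs
    refine h.not_isLimitCycleOn_of_reversible (n := ![0, v, -w]) (contDiff_crossField ..)
      (dot3_crossField _ _ _ _ _ _) (by simp [dot3]; linarith) (fun p ↦ ?_) ?_
    · funext i
      fin_cases i <;> simp [crossField, reflect_apply, dot3] <;> grind
    · obtain ⟨t, ht⟩ := exists_eq_zero_of_periodic (fun t ↦ (h.hasDerivAt_coord t).1) h.pos
        (fun t ↦ by rw [h.periodic])
      refine ⟨t, ?_⟩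
      by_contra hcon
      have h1 : v * γ t 1 - w * γ t 2 ≠ 0 := by simpa [dot3, sub_eq_add_neg] using hcon
      have h2 : γ t 0 = 0 :=
        (mul_eq_zero.1 (by linear_combination ht :
          (s * (v * γ t 1 - w * γ t 2)) * γ t 0 = 0)).resolve_left (mul_ne_zero hspos.ne' h1)
      exact h.coord_not_all_zero t (by rw [h2]; ring) (by rw [h2]; ring) (by rw [h2]; ring)

theorem not_isLimitCycleOn_crossField_of_kernel (Γ : Set (Fin 3 → ℝ)) :
    ¬ IsLimitCycleOn (crossField a 0 c 0 e f) Γ := by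
  intro hΓ
  obtain ⟨γ, T, h, rfl⟩ := isPeriodicOrbitOn_iff.1 hΓ.1
  by_cases hf : f = 0
  · subst hf
    exact not_isLimitCycleOn_of_zero h hΓ
  · exact not_isPeriodicSol_crossField_of_ne_zero h hf

end DegenerateField

section Conjugation

variable {A : Matrix (Fin 3) (Fin 3) ℝ} {X Y : (Fin 3 → ℝ) → Fin 3 → ℝ}

theorem mulVec_mem_S2 (hA : Aᵀ * A = 1) {p : Fin 3 → ℝ} (hp : p ∈ S2) : A *ᵥ p ∈ S2 := by
  have key : ∀ q : Fin 3 → ℝ, q ∈ S2 ↔ q ⬝ᵥ q = 1 := fun q ↦ by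
    simp [S2, dotProduct, Fin.sum_univ_three, sq]
  rw [key] at hp ⊢
  rw [dotProduct_mulVec, vecMul_mulVec, hA, vecMul_one, hp]

theorem IsPeriodicOrbitOn.image_mulVec (hA : Aᵀ * A = 1)
    (hXY : ∀ p, X (A *ᵥ p) = A *ᵥ Y p) {Γ : Set (Fin 3 → ℝ)} (hΓ : IsPeriodicOrbitOn Y Γ) :
    IsPeriodicOrbitOn X ((A *ᵥ ·) '' Γ) := by
  obtain ⟨γ, T, h, rfl⟩ := isPeriodicOrbitOn_iff.1 hΓ
  refine isPeriodicOrbitOn_iff.2 ⟨fun t ↦ A *ᵥ γ t, T, ⟨fun t ↦ ?_, h.pos, fun t ↦ ?_, ?_,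
    fun t ↦ mulVec_mem_S2 hA (h.mem t)⟩, ?_⟩
  · rw [hXY]
    exact ((mulVecLin A).toContinuousLinearMap.hasFDerivAt.comp_hasDerivAt t (h.hasDerivAt t))
  · rw [h.periodic]
  · intro hc
    refine h.nonconst fun t ↦ ?_
    have := congrArg (Aᵀ *ᵥ ·) (hc t)
    simpa [mulVec_mulVec, hA] using this
  · rw [← range_comp]; rfl

/-- Limit cycles are transported by orthogonal changes of coordinates. -/
theorem IsLimitCycleOn.image_transpose_mulVec (hA : Aᵀ * A = 1)
    (hXY : ∀ p, Aᵀ *ᵥ X (A *ᵥ p) = Y p) {Γ : Set (Fin 3 → ℝ)} (hΓ : IsLimitCycleOn X Γ) :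
    IsLimitCycleOn Y ((Aᵀ *ᵥ ·) '' Γ) := by
  have hA' : A * Aᵀ = 1 := mul_eq_one_comm.1 hA
  obtain ⟨h1, U, hU, hΓU, hiso⟩ := hΓ
  refine ⟨h1.image_mulVec (by rwa [transpose_transpose]) fun p ↦ ?_, (A *ᵥ ·) ⁻¹' U,
    hU.preimage (by fun_prop), ?_, fun Γ' hΓ' hΓ'U ↦ ?_⟩
  · rw [← hXY, mulVec_mulVec, hA', one_mulVec]
  · rintro _ ⟨p, hp, rfl⟩
    simpa [mulVec_mulVec, hA'] using hΓU hp
  · have := hiso _ (hΓ'.image_mulVec hA fun p ↦ by rw [← hXY, mulVec_mulVec, hA', one_mulVec])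
      (by rintro _ ⟨p, hp, rfl⟩; exact hΓ'U hp)
    rw [← this, image_image]
    simp [mulVec_mulVec, hA]

end Conjugation

section Rotation

variable {a b c d e f : ℝ}

/-- To exclude limit cycles of `crossField` one may first rotate about the third axis. -/
theorem not_isLimitCycleOn_of_rotate {p q : ℝ} (hpq : p ^ 2 + q ^ 2 = 1)
    (H : ∀ Γ, ¬ IsLimitCycleOn (crossField
      (p * (a * p + b * q) + q * (c * p + d * q)) (p * (b * p - a * q) + q * (d * p - c * q))
      (p * (c * p + d * q) - q * (a * p + b * q)) (p * (d * p - c * q) - q * (b * p - a * q))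
      (e * p + f * q) (f * p - e * q)) Γ) (Γ : Set (Fin 3 → ℝ)) :
    ¬ IsLimitCycleOn (crossField a b c d e f) Γ := by
  intro hΓ
  refine H _ (hΓ.image_transpose_mulVec (A := !![p, -q, 0; q, p, 0; 0, 0, 1]) ?_ fun v ↦ ?_)
  · ext i j
    fin_cases i <;> fin_cases j <;>
      simp [Matrix.mul_apply, Fin.sum_univ_three] <;> linarith
  · funext i
    fin_cases i <;> simp [crossField, mulVec, dotProduct, Fin.sum_univ_three] <;> grind

theorem exists_unit_kernel (h : a * d - b * c = 0) :
    ∃ p q : ℝ, p ^ 2 + q ^ 2 = 1 ∧ b * p - a * q = 0 ∧ d * p - c * q = 0 := by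
  obtain ⟨u, v, huv, h1, h2⟩ : ∃ u v : ℝ, 0 < u ^ 2 + v ^ 2 ∧ b * u - a * v = 0 ∧
      d * u - c * v = 0 := by
    by_cases hab : a = 0 ∧ b = 0
    · by_cases hcd : c = 0 ∧ d = 0
      · exact ⟨1, 0, by norm_num, by simp [hab], by simp [hcd]⟩
      · refine ⟨c, d, ?_, by simp [hab], by ring⟩
        by_contra hcon
        exact hcd ⟨by nlinarith, by nlinarith⟩
    · refine ⟨a, b, ?_, by ring, by linarith⟩
      by_contra hcon
      exact hab ⟨by nlinarith, by nlinarith⟩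
  have hs : √(u ^ 2 + v ^ 2) ^ 2 = u ^ 2 + v ^ 2 := Real.sq_sqrt huv.le
  have hspos : 0 < √(u ^ 2 + v ^ 2) := by positivity
  refine ⟨u / √(u ^ 2 + v ^ 2), v / √(u ^ 2 + v ^ 2), ?_, ?_, ?_⟩
  · field_simp; linarith
  · field_simp; linarith
  · field_simp; linarith

theorem exists_diagonalizing_rotation (a b d : ℝ) :
    ∃ p q : ℝ, p ^ 2 + q ^ 2 = 1 ∧ p * (b * p - a * q) + q * (d * p - b * q) = 0 := by
  set g : ℝ → ℝ := fun θ ↦ Real.cos θ * (b * Real.cos θ - a * Real.sin θ) +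
    Real.sin θ * (d * Real.cos θ - b * Real.sin θ) with hg
  have hc : Continuous g := by fun_prop
  have h0 : g 0 = b := by simp [hg]
  have h1 : g (Real.pi / 2) = -b := by simp [hg]
  obtain ⟨θ, hθ⟩ : ∃ θ, g θ = 0 := by
    refine mem_range_of_exists_le_of_exists_ge hc ?_ ?_
    · rcases le_total b 0 with hb | hb
      · exact ⟨0, by linarith⟩
      · exact ⟨Real.pi / 2, by linarith⟩
    · rcases le_total b 0 with hb | hb
      · exact ⟨Real.pi / 2, by linarith⟩
      · exact ⟨0, by linarith⟩
  exact ⟨Real.cos θ, Real.sin θ, Real.cos_sq_add_sin_sq θ, hθ⟩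

theorem not_isLimitCycleOn_of_det_eq_zero (h : a * d - b * c = 0) (Γ : Set (Fin 3 → ℝ)) :
    ¬ IsLimitCycleOn (crossField a b c d e f) Γ := by
  obtain ⟨p, q, hpq, h1, h2⟩ := exists_unit_kernel h
  refine not_isLimitCycleOn_of_rotate hpq (fun Γ ↦ ?_) Γ
  rw [h1, h2]
  simp only [mul_zero, add_zero, sub_zero]
  exact not_isLimitCycleOn_crossField_of_kernel Γ

end Rotation

section ReversibleCenter

variable {a d f T : ℝ} {γ : ℝ → Fin 3 → ℝ}

theorem not_isPeriodicSol_of_pos_of_diagonal (h : IsPeriodicSol (crossField a 0 0 d 0 f) γ T)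
    (ha : a ≠ 0) (hf : f ≠ 0) (hx : ∀ t, 0 < γ t 0) : False := by
  have hx0 := hx 0
  by_cases had : d - a = 0
  · obtain rfl : d = a := by linarith
    have hd : ∀ t, HasDerivAt (fun s ↦ f * (d * γ s 2 - f * γ s 1) ^ 2)
        (-(2 * f ^ 2 * γ t 0 * (d * γ t 2 - f * γ t 1) ^ 2)) t := fun t ↦
      (((((h.hasDerivAt_coord t).2.2.const_mul d).sub
        ((h.hasDerivAt_coord t).2.1.const_mul f)).pow 2).const_mul f).congr_deriv (by
          simp only [Pi.sub_apply]; push_cast; ring)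
    have h0 := deriv_eq_zero_of_periodic_of_nonpos hd h.pos (fun t ↦ by rw [h.periodic])
      (fun t ↦ by have := hx t; rw [neg_nonpos]; positivity) 0
    have hW : d * γ 0 2 - f * γ 0 1 = 0 := by simpa [hf, hx0.ne'] using h0
    exact h.coord_not_all_zero 0 (by linear_combination (-γ 0 1) * hW)
      (by linear_combination γ 0 0 * hW) (by ring)
  · have hd : ∀ t, HasDerivAt (fun s ↦ f * (d - a) * ((d - a) * γ s 1 ^ 2 - a * γ s 2 ^ 2))
        (-(2 * f ^ 2 * (d - a) ^ 2 * γ t 0 * γ t 1 ^ 2)) t := fun t ↦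
      (((((h.hasDerivAt_coord t).2.1.pow 2).const_mul (d - a)).sub
        (((h.hasDerivAt_coord t).2.2.pow 2).const_mul a)).const_mul (f * (d - a))).congr_deriv (by
          push_cast; ring)
    have h0 := deriv_eq_zero_of_periodic_of_nonpos hd h.pos (fun t ↦ by rw [h.periodic])
      (fun t ↦ by have := hx t; rw [neg_nonpos]; positivity)
    have hy : ∀ t, γ t 1 = 0 := fun t ↦ by simpa [hf, (hx t).ne', had] using h0 t
    have hy' := (h.hasDerivAt_coord 0).2.1.unique
      (by simp only [hy]; exact hasDerivAt_const _ _)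
    have hz : γ 0 2 = 0 := by simpa [hy, ha, hx0.ne'] using hy'
    exact h.coord_not_all_zero 0 (by rw [hy, hz]; ring) (by rw [hy, hz]; ring)
      (by rw [hy]; ring)

theorem not_isLimitCycleOn_of_diagonal (ha : a ≠ 0) (hd : d ≠ 0) (Γ : Set (Fin 3 → ℝ)) :
    ¬ IsLimitCycleOn (crossField a 0 0 d 0 f) Γ := by
  intro hΓ
  obtain ⟨γ, T, h, rfl⟩ := isPeriodicOrbitOn_iff.1 hΓ.1
  revert hΓ
  by_cases hf : f = 0
  · subst hf
    obtain ⟨t, ht⟩ := exists_eq_zero_of_periodic (fun t ↦ (h.hasDerivAt_coord t).1) h.pos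
      (fun t ↦ by rw [h.periodic])
    have hyz : γ t 1 = 0 ∨ γ t 2 = 0 := by
      have : γ t 2 = 0 ∨ d = 0 ∨ γ t 1 = 0 := by simpa using ht
      tauto
    rcases hyz with hy | hz
    · refine h.not_isLimitCycleOn_of_reversible (n := ![0, 1, 0]) (contDiff_crossField ..)
        (dot3_crossField _ _ _ _ _ _) (by simp [dot3]) (fun p ↦ ?_) ⟨t, by simp [dot3, hy]⟩
      funext i
      fin_cases i <;> simp [crossField, reflect_apply, dot3] <;> ring
    · refine h.not_isLimitCycleOn_of_reversible (n := ![0, 0, 1]) (contDiff_crossField ..)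
        (dot3_crossField _ _ _ _ _ _) (by simp [dot3]) (fun p ↦ ?_) ⟨t, by simp [dot3, hz]⟩
      funext i
      fin_cases i <;> simp [crossField, reflect_apply, dot3] <;> ring
  · have hx : ∃ t, γ t 0 = 0 := by
      by_contra! hne
      rcases pos_or_neg_of_ne_zero (continuous_iff_continuousAt.2 fun t ↦
        (h.hasDerivAt_coord t).1.continuousAt) hne with hx | hx
      · exact not_isPeriodicSol_of_pos_of_diagonal h ha hf hx
      · exact not_isPeriodicSol_of_pos_of_diagonal h.crossField_antipodal ha hf
          fun t ↦ by simpa using hx (-t)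
    obtain ⟨t, ht⟩ := hx
    refine h.not_isLimitCycleOn_of_reversible (n := ![1, 0, 0]) (contDiff_crossField ..)
      (dot3_crossField _ _ _ _ _ _) (by simp [dot3]) (fun p ↦ ?_) ⟨t, by simp [dot3, ht]⟩
    funext i
    fin_cases i <;> simp [crossField, reflect_apply, dot3] <;> ring

theorem exists_unit_orthogonal (e f : ℝ) :
    ∃ p q : ℝ, p ^ 2 + q ^ 2 = 1 ∧ e * p + f * q = 0 := by
  obtain ⟨p, q, hpq, h, -⟩ := exists_unit_kernel (a := -f) (b := e) (c := 0) (d := 0) (by ring)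
  exact ⟨p, q, hpq, by linarith⟩

/-- A diagonal field with a coordinate plane of symmetry has no limit cycles. -/
theorem not_isLimitCycleOn_of_mul_eq_zero {e : ℝ} (ha : a ≠ 0) (hd : d ≠ 0)
    (h : e * f * (d - a) = 0) (Γ : Set (Fin 3 → ℝ)) :
    ¬ IsLimitCycleOn (crossField a 0 0 d e f) Γ := by
  rcases mul_eq_zero.1 h with h | h
  · rcases mul_eq_zero.1 h with rfl | rfl
    · exact not_isLimitCycleOn_of_diagonal ha hd Γ
    · refine not_isLimitCycleOn_of_rotate (p := 0) (q := 1) (by norm_num) (fun Γ ↦ ?_) Γ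
      simpa using not_isLimitCycleOn_of_diagonal hd ha Γ
  · obtain rfl : d = a := by linarith
    obtain ⟨p, q, hpq, h0⟩ := exists_unit_orthogonal e f
    refine not_isLimitCycleOn_of_rotate hpq (fun Γ ↦ ?_) Γ
    convert not_isLimitCycleOn_of_diagonal (f := f * p - e * q) ha ha Γ using 2
    rw [h0]
    congr 1
    · linear_combination d * hpq
    · ring
    · ring
    · linear_combination d * hpq

end ReversibleCenter

/-- Every orbit through a point of a punctured neighbourhood of the origin is periodic. -/
def HasLocallyPeriodicFlow (F : ℝ × ℝ → ℝ × ℝ) : Prop :=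
  ∃ U ∈ 𝓝 (0 : ℝ × ℝ), ∀ p ∈ U, p ≠ 0 → ∃ (γ : ℝ → ℝ × ℝ) (T : ℝ),
    γ 0 = p ∧ (∀ t, HasDerivAt γ (F (γ t)) t) ∧ 0 < T ∧ ∀ t, γ (t + T) = γ t

theorem IsCenter.hasLocallyPeriodicFlow {F : ℝ × ℝ → ℝ × ℝ} (h : IsCenter F (0, 0)) :
    HasLocallyPeriodicFlow F := by
  obtain ⟨-, U, hU, h⟩ := h
  refine ⟨U, hU, fun p hp hp0 ↦ ?_⟩
  obtain ⟨γ, T, h0, hd, hT, hper, -⟩ := h p hp hp0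
  exact ⟨γ, T, h0, hd, hT, hper⟩

theorem HasLocallyPeriodicFlow.neg {F : ℝ × ℝ → ℝ × ℝ} (h : HasLocallyPeriodicFlow F) :
    HasLocallyPeriodicFlow fun p ↦ -F p := by
  obtain ⟨U, hU, h⟩ := h
  refine ⟨U, hU, fun p hp hp0 ↦ ?_⟩
  obtain ⟨γ, T, h0, hd, hT, hper⟩ := h p hp hp0
  refine ⟨fun t ↦ γ (-t), T, by simpa using h0, fun t ↦ ?_, hT, fun t ↦ ?_⟩
  · have := (hd (-t)).scomp t (hasDerivAt_neg t)
    simpa [Function.comp_def] using this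
  · change γ (-(t + T)) = γ (-t)
    rw [← hper (-(t + T))]
    congr 1
    ring

/-- A strict Lyapunov function excludes periodic orbits near the origin. -/
theorem not_hasLocallyPeriodicFlow_of_lyapunov {F : ℝ × ℝ → ℝ × ℝ} {V W : ℝ × ℝ → ℝ} {r m m' : ℝ}
    (hr : 0 < r) (hm : 0 < m) (hm' : 0 < m') (hV0 : V 0 = 0) (hVc : ContinuousAt V 0)
    (hd : ∀ (γ : ℝ → ℝ × ℝ) (t : ℝ), HasDerivAt γ (F (γ t)) t →
      HasDerivAt (fun s ↦ V (γ s)) (W (γ t)) t)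
    (hV : ∀ p, ‖p‖ ≤ r → m * ‖p‖ ^ 2 ≤ V p) (hW : ∀ p, ‖p‖ ≤ r → m' * ‖p‖ ^ 4 ≤ -W p) :
    ¬ HasLocallyPeriodicFlow F := by
  rintro ⟨U, hU, h⟩
  have hev : ∀ᶠ p in 𝓝 (0 : ℝ × ℝ), p ∈ U ∧ V p < m * r ^ 2 ∧ ‖p‖ < r := by
    refine (eventually_mem_set.2 hU).and ((hVc.eventually (gt_mem_nhds ?_)).and ?_)
    · rw [hV0]; positivity
    · exact continuous_norm.continuousAt.eventually (gt_mem_nhds (by simpa using hr))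
  obtain ⟨p, ⟨hpU, hpV, hpr⟩, hp0⟩ : ∃ p : ℝ × ℝ, (p ∈ U ∧ V p < m * r ^ 2 ∧ ‖p‖ < r) ∧ p ≠ 0 :=
    ((hev.filter_mono nhdsWithin_le_nhds).and (self_mem_nhdsWithin (s := {0}ᶜ))).exists
  obtain ⟨γ, T, h0, hγ, hT, hper⟩ := h p hpU hp0
  have hγc : Continuous γ := continuous_iff_continuousAt.2 fun t ↦ (hγ t).continuousAt
  have hWnp : ∀ p, ‖p‖ ≤ r → W p ≤ 0 := fun p hp ↦ by
    have := hW p hp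
    have : 0 ≤ m' * ‖p‖ ^ 4 := by positivity
    linarith
  have htrap : ∀ t, 0 ≤ t → ‖γ t‖ < r := by
    by_contra! hcon
    obtain ⟨t₁, ht₁, hrt₁⟩ := hcon
    have hK : IsCompact {t | t ∈ Icc 0 t₁ ∧ r ≤ ‖γ t‖} :=
      isCompact_Icc.inter_right (isClosed_le continuous_const hγc.norm)
    obtain ⟨τ, ⟨hτ, hτr⟩, hleast⟩ := hK.exists_isLeast ⟨t₁, ⟨ht₁, le_rfl⟩, hrt₁⟩
    have hbefore : ∀ t ∈ Ico 0 τ, ‖γ t‖ < r := fun t ht ↦ by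
      by_contra! hcon
      have := hleast ⟨⟨ht.1, ht.2.le.trans hτ.2⟩, hcon⟩
      linarith [ht.2]
    have hτeq : ‖γ τ‖ = r := by
      obtain ⟨s, hs, hsr⟩ := intermediate_value_Icc hτ.1 hγc.norm.continuousOn
        (⟨by rw [h0]; exact hpr.le, hτr⟩ : r ∈ Icc ‖γ 0‖ ‖γ τ‖)
      rcases hs.2.eq_or_lt with rfl | hlt
      · exact hsr
      · exact absurd hsr (hbefore s ⟨hs.1, hlt⟩).ne
    have hanti : AntitoneOn (fun t ↦ V (γ t)) (Icc 0 τ) := by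
      refine antitoneOn_of_deriv_nonpos (convex_Icc _ _)
        (fun t _ ↦ (hd γ t (hγ t)).continuousAt.continuousWithinAt)
        (fun t _ ↦ (hd γ t (hγ t)).differentiableAt.differentiableWithinAt) fun t ht ↦ ?_
      rw [interior_Icc] at ht
      rw [(hd γ t (hγ t)).deriv]
      exact hWnp _ (hbefore t ⟨ht.1.le, ht.2⟩).le
    have h1 : V (γ τ) ≤ V (γ 0) := hanti ⟨le_rfl, hτ.1⟩ ⟨hτ.1, le_rfl⟩ hτ.1
    have h2 := hV (γ τ) hτeq.le
    rw [hτeq] at h2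
    rw [h0] at h1
    linarith
  have hall : ∀ t, ‖γ t‖ < r := fun t ↦ by
    obtain ⟨y, hy, hys⟩ := Function.Periodic.exists_mem_Ico₀ (f := γ) (c := T) hper hT t
    rw [hys]
    exact htrap y hy.1
  have hzero := deriv_eq_zero_of_periodic_of_nonpos (fun t ↦ hd γ t (hγ t)) hT
    (fun t ↦ by rw [hper]) (fun t ↦ hWnp _ (hall t).le) 0
  have hlast := hW (γ 0) (hall 0).le
  rw [hzero, h0] at hlast
  have : 0 < m' * ‖p‖ ^ 4 := by
    have := norm_pos_iff.2 hp0
    positivity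
  linarith

section Homogeneous

theorem exists_norm_bound_of_homogeneous {h : ℝ × ℝ → ℝ} {k : ℕ} (hc : Continuous h)
    (hh : ∀ (s : ℝ) p, h (s • p) = s ^ k * h p) : ∃ C, 0 ≤ C ∧ ∀ p, |h p| ≤ C * ‖p‖ ^ k := by
  obtain ⟨C, hC⟩ := (isCompact_closedBall (0 : ℝ × ℝ) 1).exists_bound_of_continuousOn
    hc.continuousOn
  have hC0 : 0 ≤ C := (norm_nonneg _).trans (hC 0 (by simp))
  refine ⟨C, hC0, fun p ↦ ?_⟩
  have hp : p = ‖p‖ • (‖p‖⁻¹ • p) := by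
    by_cases hp : p = 0
    · simp [hp]
    · rw [smul_inv_smul₀ (norm_ne_zero_iff.2 hp)]
  have hmem : ‖p‖⁻¹ • p ∈ Metric.closedBall (0 : ℝ × ℝ) 1 := by
    rw [mem_closedBall_zero_iff, norm_smul, norm_inv, norm_norm]
    exact inv_mul_le_one
  have h1 := hC _ hmem
  rw [Real.norm_eq_abs] at h1
  calc |h p| = ‖p‖ ^ k * |h (‖p‖⁻¹ • p)| := by
        conv_lhs => rw [hp, hh, abs_mul, abs_of_nonneg (by positivity)]
    _ ≤ ‖p‖ ^ k * C := by gcongr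
    _ = C * ‖p‖ ^ k := mul_comm _ _

theorem exists_lower_bound_of_homogeneous {h : ℝ × ℝ → ℝ} {k : ℕ} (hc : Continuous h)
    (hh : ∀ (s : ℝ) p, h (s • p) = s ^ k * h p) (hpos : ∀ p, p ≠ 0 → 0 < h p) :
    ∃ c, 0 < c ∧ ∀ p, p ≠ 0 → c * ‖p‖ ^ k ≤ h p := by
  obtain ⟨q, hq, hmin⟩ := (isCompact_sphere (0 : ℝ × ℝ) 1).exists_isMinOn
    (NormedSpace.sphere_nonempty.2 zero_le_one) hc.continuousOn
  have hq0 : q ≠ 0 := by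
    rintro rfl
    simp at hq
  refine ⟨h q, hpos q hq0, fun p hp ↦ ?_⟩
  have hp' : ‖p‖ ≠ 0 := norm_ne_zero_iff.2 hp
  have h1 : h q ≤ h (‖p‖⁻¹ • p) := hmin (by
    simp [norm_smul, inv_mul_cancel₀ hp'])
  calc h q * ‖p‖ ^ k ≤ h (‖p‖⁻¹ • p) * ‖p‖ ^ k := by gcongr
    _ = h p := by rw [mul_comm, ← hh, smul_inv_smul₀ hp']

/-- Near the origin, a positive definite form dominates terms of higher order. -/
theorem exists_lower_bound_of_leading_form {h h₁ h₂ : ℝ × ℝ → ℝ} {k : ℕ} (hk : k ≠ 0)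
    (hc : Continuous h) (hc₁ : Continuous h₁) (hc₂ : Continuous h₂)
    (hh : ∀ (s : ℝ) p, h (s • p) = s ^ k * h p)
    (hh₁ : ∀ (s : ℝ) p, h₁ (s • p) = s ^ (k + 1) * h₁ p)
    (hh₂ : ∀ (s : ℝ) p, h₂ (s • p) = s ^ (k + 2) * h₂ p) (hpos : ∀ p, p ≠ 0 → 0 < h p) :
    ∃ r m, 0 < r ∧ 0 < m ∧ ∀ p, ‖p‖ ≤ r → m * ‖p‖ ^ k ≤ h p + h₁ p + h₂ p := by
  obtain ⟨c, hc0, hcb⟩ := exists_lower_bound_of_homogeneous hc hh hpos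
  obtain ⟨C₁, hC₁, hb₁⟩ := exists_norm_bound_of_homogeneous hc₁ hh₁
  obtain ⟨C₂, hC₂, hb₂⟩ := exists_norm_bound_of_homogeneous hc₂ hh₂
  refine ⟨min 1 (c / (2 * (C₁ + C₂ + 1))), c / 2, by positivity, by positivity, fun p hp ↦ ?_⟩
  have hp1 : ‖p‖ ≤ 1 := hp.trans (min_le_left _ _)
  have hp2 : ‖p‖ ≤ c / (2 * (C₁ + C₂ + 1)) := hp.trans (min_le_right _ _)
  by_cases hp0 : p = 0
  · subst hp0
    have e0 := hh 0 0
    have e1 := hh₁ 0 0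
    have e2 := hh₂ 0 0
    simp [hk] at e0 e1 e2
    simp [hk, e0, e1, e2]
  have h0 := hcb p hp0
  have h1 := (abs_le.1 (hb₁ p)).1
  have h2 := (abs_le.1 (hb₂ p)).1
  have hN : 0 ≤ ‖p‖ := norm_nonneg p
  have hNk : 0 ≤ ‖p‖ ^ k := by positivity
  have e1 : C₁ * ‖p‖ ^ (k + 1) = C₁ * ‖p‖ * ‖p‖ ^ k := by ring
  have e2 : C₂ * ‖p‖ ^ (k + 2) ≤ C₂ * ‖p‖ * ‖p‖ ^ k := by
    rw [show C₂ * ‖p‖ ^ (k + 2) = C₂ * ‖p‖ * ‖p‖ ^ k * ‖p‖ by ring]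
    exact mul_le_of_le_one_right (by positivity) hp1
  have e3 : (C₁ + C₂) * ‖p‖ ≤ c / 2 := by
    rw [le_div_iff₀ (by positivity)] at hp2
    nlinarith
  have e4 := mul_le_mul_of_nonneg_right e3 hNk
  linarith

end Homogeneous

theorem hasDerivAt_form {γ : ℝ → ℝ × ℝ} {w : ℝ × ℝ} {t : ℝ} (hγ : HasDerivAt γ w t)
    (k₁ k₂ α β p q s u : ℝ) :
    HasDerivAt (fun t ↦ (k₁ * (γ t).1 ^ 2 + k₂ * (γ t).2 ^ 2)
      + (α * (γ t).1 ^ 3 + β * (γ t).2 ^ 3) + (p * (γ t).1 ^ 4 + q * (γ t).2 ^ 4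
        + s * ((γ t).1 ^ 3 * (γ t).2) + u * ((γ t).1 * (γ t).2 ^ 3)))
      ((2 * k₁ * (γ t).1 + 3 * α * (γ t).1 ^ 2 + 4 * p * (γ t).1 ^ 3
          + 3 * s * (γ t).1 ^ 2 * (γ t).2 + u * (γ t).2 ^ 3) * w.1
        + (2 * k₂ * (γ t).2 + 3 * β * (γ t).2 ^ 2 + 4 * q * (γ t).2 ^ 3
          + s * (γ t).1 ^ 3 + 3 * u * (γ t).1 * (γ t).2 ^ 2) * w.2) t := by
  have h1 : HasDerivAt (fun t ↦ (γ t).1) w.1 t := hγ.fst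
  have h2 : HasDerivAt (fun t ↦ (γ t).2) w.2 t := hγ.snd
  refine (((((h1.pow 2).const_mul k₁).add ((h2.pow 2).const_mul k₂)).add
    (((h1.pow 3).const_mul α).add ((h2.pow 3).const_mul β))).add
    (((((h1.pow 4).const_mul p).add ((h2.pow 4).const_mul q)).add
      (((h1.pow 3).mul h2).const_mul s)).add ((h1.mul (h2.pow 3)).const_mul u))).congr_deriv ?_
  simp only [Pi.pow_apply]
  push_cast
  ring

/-- In diagonal form, the first focal value of the center-focus equilibrium is a multiple of
`e * f * (d - a)`. -/
theorem HasLocallyPeriodicFlow.mul_eq_zero {a d e f : ℝ} (had : 0 < a * d)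
    (h : HasLocallyPeriodicFlow (sysDagger e f 0 (-d) a 0)) : e * f * (d - a) = 0 := by
  by_contra hne
  have ha : a ≠ 0 := left_ne_zero_of_mul had.ne'
  have hd : d ≠ 0 := right_ne_zero_of_mul had.ne'
  have hsum : a + d ≠ 0 := fun h0 ↦ by
    have : a * d = -a ^ 2 := by rw [eq_neg_of_add_eq_zero_right h0]; ring
    nlinarith [sq_nonneg a]
  obtain ⟨α, hα⟩ : ∃ α, 3 * d * α = 2 * (d - a) * e := ⟨2 * (d - a) * e / (3 * d), by field_simp⟩
  obtain ⟨β, hβ⟩ : ∃ β, 3 * a * β = -(2 * (d - a) * f) :=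
    ⟨-(2 * (d - a) * f) / (3 * a), by field_simp⟩
  obtain ⟨p, hp⟩ : ∃ p, 4 * d * p = -(3 * α * e + 2 * (d - a) * a) :=
    ⟨-(3 * α * e + 2 * (d - a) * a) / (4 * d), by field_simp⟩
  obtain ⟨q, hq⟩ : ∃ q, 4 * a * q = -(3 * β * f) + 2 * (d - a) * d :=
    ⟨(-(3 * β * f) + 2 * (d - a) * d) / (4 * a), by field_simp⟩
  obtain ⟨K, hK⟩ : ∃ K, K = 3 * (α * f - β * e) := ⟨_, rfl⟩
  obtain ⟨s, hs⟩ : ∃ s, 9 * d * s = -K := ⟨-K / (9 * d), by field_simp⟩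
  obtain ⟨u, hu⟩ : ∃ u, 9 * a * u = K := ⟨K / (9 * a), by field_simp⟩
  have hK0 : a * K ≠ 0 := by
    have : a * d * K = 2 * (e * f * (d - a)) * (a + d) := by
      rw [hK]; linear_combination a * f * hα - d * e * hβ
    have : a * d * K ≠ 0 := by rw [this]; exact mul_ne_zero (mul_ne_zero two_ne_zero hne) hsum
    exact mul_ne_zero ha (right_ne_zero_of_mul this)
  have hsq : ∀ w : ℝ × ℝ, w ≠ 0 → w.1 ≠ 0 ∨ w.2 ≠ 0 := fun w hw ↦ by
    by_contra! hcon
    exact hw (Prod.ext hcon.1 hcon.2)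
  let V : ℝ × ℝ → ℝ := fun w ↦ (a * a * w.1 ^ 2 + a * d * w.2 ^ 2)
    + (a * α * w.1 ^ 3 + a * β * w.2 ^ 3) + (a * p * w.1 ^ 4 + a * q * w.2 ^ 4
      + a * s * (w.1 ^ 3 * w.2) + a * u * (w.1 * w.2 ^ 3))
  obtain ⟨r, m, hr, hm, hV⟩ : ∃ r m, 0 < r ∧ 0 < m ∧ ∀ w, ‖w‖ ≤ r → m * ‖w‖ ^ 2 ≤ V w := by
    refine exists_lower_bound_of_leading_form two_ne_zero (by fun_prop) (by fun_prop)
      (by fun_prop) ?_ ?_ ?_ fun w hw ↦ ?_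
    · intro s p; simp only [Prod.smul_fst, Prod.smul_snd, smul_eq_mul]; ring
    · intro s p; simp only [Prod.smul_fst, Prod.smul_snd, smul_eq_mul]; ring
    · intro s p; simp only [Prod.smul_fst, Prod.smul_snd, smul_eq_mul]; ring
    · have haa : 0 < a * a := mul_self_pos.2 ha
      rcases hsq w hw with hw | hw
      · exact add_pos_of_pos_of_nonneg (mul_pos haa (by positivity)) (by nlinarith [sq_nonneg w.2])
      · exact add_pos_of_nonneg_of_pos (by nlinarith [sq_nonneg w.1]) (mul_pos had (by positivity))
  let W₄ : ℝ × ℝ → ℝ := fun w ↦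
    -(a * K) * (w.1 ^ 2 * w.2 ^ 2 / 3 + a / d * w.1 ^ 4 / 9 + d / a * w.2 ^ 4 / 9)
  let W₅ : ℝ × ℝ → ℝ := fun w ↦
    -a * (((4 * p * w.1 ^ 3 + 3 * s * w.1 ^ 2 * w.2 + u * w.2 ^ 3) * w.2
      - (4 * q * w.2 ^ 3 + s * w.1 ^ 3 + 3 * u * w.1 * w.2 ^ 2) * w.1) * (e * w.1 + f * w.2)
      + 3 * (α * w.1 ^ 3 + β * w.2 ^ 3) * ((d - a) * w.1 * w.2))
  let W₆ : ℝ × ℝ → ℝ := fun w ↦ -a * (4 * (p * w.1 ^ 4 + q * w.2 ^ 4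
      + s * (w.1 ^ 3 * w.2) + u * (w.1 * w.2 ^ 3)) * ((d - a) * w.1 * w.2))
  have hW (σ : ℝ) (hσ : σ * (a * K) < 0) : ∃ r' m', 0 < r' ∧ 0 < m' ∧ ∀ w, ‖w‖ ≤ r' →
      m' * ‖w‖ ^ 4 ≤ σ * W₄ w + σ * W₅ w + σ * W₆ w := by
    refine exists_lower_bound_of_leading_form four_ne_zero (by fun_prop) (by fun_prop)
      (by fun_prop) ?_ ?_ ?_ fun w hw ↦ ?_
    · intro s p; simp only [W₄, Prod.smul_fst, Prod.smul_snd, smul_eq_mul]; ring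
    · intro s p; simp only [W₅, Prod.smul_fst, Prod.smul_snd, smul_eq_mul]; ring
    · intro s p; simp only [W₆, Prod.smul_fst, Prod.smul_snd, smul_eq_mul]; ring
    · have h1 : 0 < a / d := by
        rw [← mul_div_mul_right _ _ hd]; exact div_pos had (mul_self_pos.2 hd)
      have h2 : 0 < d / a := by rw [← inv_div]; exact inv_pos.2 h1
      rw [show σ * W₄ w = -(σ * (a * K)) * (w.1 ^ 2 * w.2 ^ 2 / 3 + a / d * w.1 ^ 4 / 9
        + d / a * w.2 ^ 4 / 9) by simp only [W₄]; ring]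
      refine mul_pos (neg_pos.2 hσ) ?_
      rcases hsq w hw with hw | hw <;> positivity
  have hder (σ : ℝ) (γ : ℝ → ℝ × ℝ) (t : ℝ)
      (hγ : HasDerivAt γ (σ • sysDagger e f 0 (-d) a 0 (γ t)) t) :
      HasDerivAt (fun t ↦ V (γ t)) (-(σ * W₄ (γ t) + σ * W₅ (γ t) + σ * W₆ (γ t))) t := by
    refine (hasDerivAt_form hγ _ _ _ _ _ _ _ _).congr_deriv ?_
    have hs' : a * K * (a / d) = -(9 * a * a * s) := by
      field_simp
      linear_combination hs
    have hu' : a * K * (d / a) = 9 * a * d * u := by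
      field_simp
      linear_combination -hu
    simp only [W₄, W₅, W₆, sysDagger, Prod.smul_fst, Prod.smul_snd, smul_eq_mul]
    generalize (γ t).1 = x at *
    generalize (γ t).2 = y at *
    linear_combination σ * a * x ^ 2 * y * hα - σ * a * x * y ^ 2 * hβ + σ * a * x ^ 3 * y * hp
      - σ * a * x * y ^ 3 * hq + σ * a * x ^ 2 * y ^ 2 * (hs / 3 - hu / 3 - hK)
      - σ / 9 * x ^ 4 * hs' - σ / 9 * y ^ 4 * hu'
  have key (σ : ℝ) (hσ : σ * (a * K) < 0) :
      ¬ HasLocallyPeriodicFlow fun w ↦ σ • sysDagger e f 0 (-d) a 0 w := by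
    obtain ⟨r', m', hr', hm', hW⟩ := hW σ hσ
    refine not_hasLocallyPeriodicFlow_of_lyapunov (V := V)
      (W := fun w ↦ -(σ * W₄ w + σ * W₅ w + σ * W₆ w)) (lt_min hr hr') hm hm' ?_ ?_ (hder σ)
      (fun w hw ↦ hV w (hw.trans (min_le_left _ _)))
      (fun w hw ↦ ?_)
    · simp [V]
    · fun_prop
    · rw [neg_neg]
      exact hW w (hw.trans (min_le_right _ _))
  rcases hK0.lt_or_gt with hneg | hpos
  · refine key 1 (by linarith) ?_
    simpa using h
  · refine key (-1) (by linarith) ?_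
    simpa using h.neg

theorem HasLocallyPeriodicFlow.rotate {a b c d e f p q : ℝ} (hpq : p ^ 2 + q ^ 2 = 1)
    (h : HasLocallyPeriodicFlow (sysDagger e f (-c) (-d) a b)) :
    HasLocallyPeriodicFlow (sysDagger (e * p + f * q) (f * p - e * q)
      (-(p * (c * p + d * q) - q * (a * p + b * q))) (-(p * (d * p - c * q) - q * (b * p - a * q)))
      (p * (a * p + b * q) + q * (c * p + d * q)) (p * (b * p - a * q) + q * (d * p - c * q))) := by
  obtain ⟨U, hU, h⟩ := h
  have hc : Continuous fun v : ℝ × ℝ ↦ (p * v.1 - q * v.2, q * v.1 + p * v.2) := by fun_prop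
  refine ⟨(fun v : ℝ × ℝ ↦ (p * v.1 - q * v.2, q * v.1 + p * v.2)) ⁻¹' U,
    hc.continuousAt.preimage_mem_nhds (by simpa [← Prod.zero_eq_mk] using hU), fun v hv hv0 ↦ ?_⟩
  obtain ⟨γ, T, h0, hd, hT, hper⟩ := h _ hv fun h0 ↦ hv0 <| by
    have h1 : p * v.1 - q * v.2 = 0 := congrArg Prod.fst h0
    have h2 : q * v.1 + p * v.2 = 0 := congrArg Prod.snd h0
    ext
    · simp only [Prod.fst_zero]; linear_combination p * h1 + q * h2 - v.1 * hpq
    · simp only [Prod.snd_zero]; linear_combination p * h2 - q * h1 - v.2 * hpq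
  refine ⟨fun t ↦ (p * (γ t).1 + q * (γ t).2, p * (γ t).2 - q * (γ t).1), T, ?_, fun t ↦ ?_, hT,
    fun t ↦ by simp only [hper]⟩
  · simp only [h0]
    ext
    · linear_combination v.1 * hpq
    · linear_combination v.2 * hpq
  · have h1 : HasDerivAt (fun t ↦ (γ t).1) _ t := (hd t).fst
    have h2 : HasDerivAt (fun t ↦ (γ t).2) _ t := (hd t).snd
    refine (((h1.const_mul p).add (h2.const_mul q)).prodMk
      ((h2.const_mul p).sub (h1.const_mul q))).congr_deriv ?_
    beta_reduce
    generalize γ t = w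
    obtain ⟨x, y⟩ := w
    obtain ⟨v₁, hv₁⟩ : ∃ v₁, v₁ = p * x + q * y := ⟨_, rfl⟩
    obtain ⟨v₂, hv₂⟩ : ∃ v₂, v₂ = p * y - q * x := ⟨_, rfl⟩
    have hx : x = p * v₁ - q * v₂ := by rw [hv₁, hv₂]; linear_combination -x * hpq
    have hy : y = q * v₁ + p * v₂ := by rw [hv₁, hv₂]; linear_combination -y * hpq
    have hl : (e * p + f * q) * v₁ + (f * p - e * q) * v₂ = e * x + f * y := by rw [hx, hy]; ring
    have hA₁ : (p * (a * p + b * q) + q * (c * p + d * q)) * v₁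
        + (p * (b * p - a * q) + q * (d * p - c * q)) * v₂
        = p * (a * x + b * y) + q * (c * x + d * y) := by rw [hx, hy]; ring
    have hA₂ : (p * (c * p + d * q) - q * (a * p + b * q)) * v₁
        + (p * (d * p - c * q) - q * (b * p - a * q)) * v₂
        = p * (c * x + d * y) - q * (a * x + b * y) := by rw [hx, hy]; ring
    simp only [sysDagger]
    rw [← hv₁, ← hv₂]
    generalize e * p + f * q = e' at *
    generalize f * p - e * q = f' at *
    generalize p * (a * p + b * q) + q * (c * p + d * q) = a' at *
    generalize p * (b * p - a * q) + q * (d * p - c * q) = b' at *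
    generalize p * (c * p + d * q) - q * (a * p + b * q) = c' at *
    generalize p * (d * p - c * q) - q * (b * p - a * q) = d' at *
    have hZ : v₁ * (p * (c * x + d * y) - q * (a * x + b * y))
        - v₂ * (p * (a * x + b * y) + q * (c * x + d * y))
        = x * (c * x + d * y) - y * (a * x + b * y) := by
      rw [hv₁, hv₂]
      linear_combination (x * (c * x + d * y) - y * (a * x + b * y)) * hpq
    rw [← hA₁, ← hA₂] at hZ
    ext
    · linear_combination -hA₂ - v₂ * hl - v₁ * hZ - (e * x + f * y) * hv₂
        - (x * (c * x + d * y) - y * (a * x + b * y)) * hv₁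
    · linear_combination hA₁ + v₁ * hl - v₂ * hZ + (e * x + f * y) * hv₁
        - (x * (c * x + d * y) - y * (a * x + b * y)) * hv₂

theorem eq_zero_or_pos_of_eigenvalue_re_eq_zero {t D : ℝ} {z : ℂ}
    (hz : z ^ 2 + (t : ℂ) * z + (D : ℂ) = 0) (hre : z.re = 0) : D = 0 ∨ t = 0 ∧ 0 < D := by
  have h1 := congrArg Complex.re hz
  have h2 := congrArg Complex.im hz
  simp [pow_two, hre] at h1 h2
  rcases eq_or_ne z.im 0 with h0 | h0
  · left
    simpa [h0] using h1
  · refine .inr ⟨h2.resolve_right h0, ?_⟩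
    have := mul_self_pos.2 h0
    linarith

theorem not_isLimitCycleOn_of_isCenter {a b d e f : ℝ} (hdet : 0 < a * d - b * b)
    (h : IsCenter (sysDagger e f (-b) (-d) a b) (0, 0)) (Γ : Set (Fin 3 → ℝ)) :
    ¬ IsLimitCycleOn (crossField a b b d e f) Γ := by
  obtain ⟨p, q, hpq, hdiag⟩ := exists_diagonalizing_rotation a b d
  have hdiag' : p * (b * p + d * q) - q * (a * p + b * q) = 0 := by linear_combination hdiag
  have hdet' : 0 < (p * (a * p + b * q) + q * (b * p + d * q))
      * (p * (d * p - b * q) - q * (b * p - a * q)) := by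
    have : (p * (a * p + b * q) + q * (b * p + d * q))
      * (p * (d * p - b * q) - q * (b * p - a * q)) = a * d - b * b := by
      linear_combination (a * d - b * b) * (p ^ 2 + q ^ 2 + 1) * hpq
        + (p * (b * p - a * q) + q * (d * p - b * q)) * hdiag
    rwa [this]
  refine not_isLimitCycleOn_of_rotate hpq (fun Γ ↦ ?_) Γ
  have hrot := h.hasLocallyPeriodicFlow.rotate hpq
  rw [hdiag, hdiag', neg_zero] at hrot
  rw [hdiag, hdiag']
  exact not_isLimitCycleOn_of_mul_eq_zero (left_ne_zero_of_mul hdet'.ne')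
    (right_ne_zero_of_mul hdet'.ne') (hrot.mul_eq_zero hdet') Γ

/-- If a homogeneous polynomial vector field `X` of degree 2 on `S²` has a
non-hyperbolic singularity (after a rotation of `SO(3)` taking it to `(0,0,-1)`, the
linearization `D = [[-a₄,-a₅],[-a₇,-a₈]]` of the central projection has an eigenvalue with
zero real part) which is not a weak focus (i.e. not: `tr D = 0`, `det D > 0` and not a
center), then `X` has no limit cycles on `S²`. -/
theorem stmt12 (P Q R : MvPolynomial (Fin 3) ℝ)
    (hP : P.IsHomogeneous 2) (hQ : Q.IsHomogeneous 2) (hR : R.IsHomogeneous 2)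
    (htan : ∀ p : Fin 3 → ℝ, p ∈ S2 →
      p 0 * eval p P + p 1 * eval p Q + p 2 * eval p R = 0)
    (hsing : ∃ (A : Matrix (Fin 3) (Fin 3) ℝ) (a1 a2 a4 a5 a7 a8 : ℝ),
      Aᵀ * A = 1 ∧ A.det = 1 ∧
      (∀ x y z : ℝ, Aᵀ.mulVec (Xf P Q R (A.mulVec ![x, y, z])) =
        ![a1 * x * y + a2 * y ^ 2 + a4 * x * z + a5 * y * z,
          -a1 * x ^ 2 - a2 * x * y + a7 * x * z + a8 * y * z,
          -a4 * x ^ 2 - a8 * y ^ 2 - (a5 + a7) * x * y]) ∧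
      (∃ z : ℂ, z ^ 2 + ((a4 + a8 : ℝ) : ℂ) * z + ((a4 * a8 - a5 * a7 : ℝ) : ℂ) = 0 ∧
        z.re = 0) ∧
      ¬ ((-a4 + -a8 = 0) ∧ 0 < a4 * a8 - a5 * a7 ∧
          ¬ IsCenter (sysDagger a1 a2 a4 a5 a7 a8) (0, 0))) :
    ∀ Γ, ¬ IsLimitCycleOn (Xf P Q R) Γ := by
  obtain ⟨A, a1, a2, a4, a5, a7, a8, hA, -, hX, ⟨z, hz, hre⟩, hfocus⟩ := hsing
  intro Γ hΓ
  have hXY (p : Fin 3 → ℝ) :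
      Aᵀ *ᵥ Xf P Q R (A *ᵥ p) = crossField a7 a8 (-a4) (-a5) a1 a2 p := by
    rw [show p = ![p 0, p 1, p 2] by ext i; fin_cases i <;> rfl]
    refine (hX _ _ _).trans ?_
    ext i
    fin_cases i <;> simp [crossField] <;> ring
  have hlim := hΓ.image_transpose_mulVec hA hXY
  rcases eq_zero_or_pos_of_eigenvalue_re_eq_zero hz hre with hdet | ⟨htr, hdet⟩
  · exact not_isLimitCycleOn_of_det_eq_zero (by linear_combination hdet) _ hlim
  · obtain rfl : a8 = -a4 := by linear_combination htr
    have hcenter : IsCenter (sysDagger a1 a2 a4 a5 a7 (-a4)) (0, 0) := by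
      by_contra hcenter
      exact hfocus ⟨by ring, hdet, hcenter⟩
    refine not_isLimitCycleOn_of_isCenter (by linarith) ?_ _ hlim
    simpa only [neg_neg] using hcenter
end

section
/- Let X=(P,Q,R) be a homogeneous polynomial vector field on S² of degree m, and let f∈ℝ[x,y,z] be a homogeneous polynomial of degree n such that f(x,y,0) is not identically zero. Then f = 0 is an invariant algebraic surface of X (i.e. there exists K∈ℝ[x,y,z] with P·∂f/∂x + Q·∂f/∂y + R·∂f/∂z = K·f) if and only if g(u,v) = f(u,v,−1) defines an invariant algebraic curve of the planar polynomial vector field (𝒫,𝒬) with 𝒫(u,v) = P(u,v,−1)+uR(u,v,−1) and 𝒬(u,v) = Q(u,v,−1)+vR(u,v,−1), i.e. there exists a polynomial k(u,v) with 𝒫·∂g/∂u + 𝒬·∂g/∂v = k·g. -/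
open MvPolynomial

theorem MvPolynomial.IsHomogeneous.eval_mul_const {σ R : Type*} [Fintype σ] [CommSemiring R]
    {φ : MvPolynomial σ R} {n : ℕ} (hφ : φ.IsHomogeneous n) (c : R) (p : σ → R) :
    eval (fun i => c * p i) φ = c ^ n * eval p φ := by
  rw [eval_eq', eval_eq', Finset.mul_sum]
  refine Finset.sum_congr rfl fun d hd => ?_
  have hdeg : ∑ i, d i = n := by
    rw [← Finsupp.degree_eq_sum, Finsupp.degree_eq_weight_one]
    exact hφ (mem_support_iff.mp hd)
  simp_rw [mul_pow, Finset.prod_mul_distrib, Finset.prod_pow_eq_pow_sum, hdeg]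
  ring

theorem MvPolynomial.hasDerivAt_eval_update {σ : Type*} [DecidableEq σ] (φ : MvPolynomial σ ℝ)
    (p : σ → ℝ) (i : σ) (x : ℝ) :
    HasDerivAt (fun s => eval (Function.update p i s) φ)
      (eval (Function.update p i x) (pderiv i φ)) x := by
  induction φ using MvPolynomial.induction_on with
  | C a => simpa using hasDerivAt_const x a
  | add f g hf hg => simpa using hf.fun_add hg
  | mul_X f j hf =>
    have hX : HasDerivAt (fun s => Function.update p i s j)
        (eval (Function.update p i x) (pderiv i (X j))) x := by
      by_cases hij : j = i
      · subst hij
        simpa using hasDerivAt_id' x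
      · simpa [hij, pderiv_X_of_ne hij] using hasDerivAt_const x (p j)
    refine ((hf.mul hX).congr_deriv ?_).congr_of_eventuallyEq (.of_forall fun s => ?_)
    · simp only [Derivation.leibniz, smul_eq_mul, map_add, map_mul, eval_X]
      ring
    · simp

/-- The homogenization of a bivariate polynomial, described by its values off `z = 0`. -/
theorem exists_eval_homogenization (h : MvPolynomial (Fin 2) ℝ) :
    ∃ (d : ℕ) (H : MvPolynomial (Fin 3) ℝ), ∀ w u v : ℝ,
      eval ![w * u, w * v, -w] H = w ^ d * eval ![u, v] h := by
  induction h using MvPolynomial.induction_on with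
  | C a => exact ⟨0, C a, fun w u v => by simp⟩
  | add f g hf hg =>
    obtain ⟨d, F, hF⟩ := hf
    obtain ⟨e, G, hG⟩ := hg
    refine ⟨d + e, (-X 2) ^ e * F + (-X 2) ^ d * G, fun w u v => ?_⟩
    simp [hF, hG]
    ring
  | mul_X f j hf =>
    obtain ⟨d, F, hF⟩ := hf
    refine ⟨d + 1, F * X j.castSucc, fun w u v => ?_⟩
    fin_cases j <;> simp [hF] <;> ring

theorem X_two_not_dvd {f : MvPolynomial (Fin 3) ℝ} (hf0 : ¬ ∀ x y : ℝ, eval ![x, y, 0] f = 0) :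
    ¬ X 2 ∣ f := by
  rintro ⟨g, rfl⟩
  exact hf0 fun x y => by simp

/-- A homogeneous polynomial that is divisible by a homogeneous `f` on the plane `z = -1` is
divisible by `f` outright, provided `z` does not divide `f`. -/
theorem dvd_of_eval_plane {N n : ℕ} {G f : MvPolynomial (Fin 3) ℝ}
    (hG : G.IsHomogeneous N) (hf : f.IsHomogeneous n) (hXf : ¬ X 2 ∣ f)
    (h : MvPolynomial (Fin 2) ℝ)
    (hh : ∀ u v : ℝ, eval ![u, v, -1] G = eval ![u, v] h * eval ![u, v, -1] f) :
    f ∣ G := by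
  obtain ⟨d, H, hH⟩ := exists_eval_homogenization h
  have key : (-X 2) ^ (d + n) * G = f * ((-X 2) ^ N * H) := by
    refine funext_set (fun _ => {0}ᶜ) (fun _ => (Set.finite_singleton 0).infinite_compl)
      fun p hp => ?_
    have hw : -p 2 ≠ 0 := neg_ne_zero.mpr (hp 2 trivial)
    obtain ⟨w, u, v, hw0, rfl⟩ : ∃ w u v : ℝ, w ≠ 0 ∧ p = ![w * u, w * v, -w] := by
      refine ⟨-p 2, p 0 / -p 2, p 1 / -p 2, hw, ?_⟩
      ext i
      fin_cases i
      · exact (mul_div_cancel₀ _ hw).symm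
      · exact (mul_div_cancel₀ _ hw).symm
      · simp
    have hvec : (![w * u, w * v, -w] : Fin 3 → ℝ) = fun i => w * ![u, v, -1] i := by
      ext i
      fin_cases i <;> simp
    have hGe := hG.eval_mul_const w ![u, v, -1]
    have hfe := hf.eval_mul_const w ![u, v, -1]
    rw [← hvec] at hGe hfe
    simp only [map_mul, map_pow, map_neg, eval_X, hGe, hfe, hH, hh]
    simp
    ring
  have hX : Prime (-X 2 : MvPolynomial (Fin 3) ℝ) := (X_prime (R := ℝ) (i := (2 : Fin 3))).neg
  obtain ⟨K, hK⟩ := hX.pow_dvd_of_dvd_mul_left (d + n) (by rwa [neg_dvd]) (Dvd.intro _ key)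
  refine ⟨K, mul_left_cancel₀ (pow_ne_zero (d + n) hX.ne_zero) ?_⟩
  rw [key, hK]
  ring

/-- The centrally projected field acts on `f(u,v,-1)` as the restriction of `X f + n R f`. -/
theorem projected_eq {n : ℕ} {P Q R f : MvPolynomial (Fin 3) ℝ}
    (hf : f.IsHomogeneous n) (u v : ℝ) :
    (eval ![u, v, -1] P + u * eval ![u, v, -1] R) * deriv (fun s => eval ![s, v, -1] f) u
        + (eval ![u, v, -1] Q + v * eval ![u, v, -1] R) *
            deriv (fun s => eval ![u, s, -1] f) v
      = eval ![u, v, -1] (P * pderiv 0 f + Q * pderiv 1 f + R * pderiv 2 f)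
        + n * eval ![u, v, -1] R * eval ![u, v, -1] f := by
  have hu : deriv (fun s => eval ![s, v, -1] f) u = eval ![u, v, -1] (pderiv 0 f) := by
    have hs (s : ℝ) : Function.update ![u, v, -1] 0 s = ![s, v, -1] := by
      ext i
      fin_cases i <;> simp
    simpa only [hs] using (hasDerivAt_eval_update f ![u, v, -1] 0 u).deriv
  have hv : deriv (fun s => eval ![u, s, -1] f) v = eval ![u, v, -1] (pderiv 1 f) := by
    have hs (s : ℝ) : Function.update ![u, v, -1] 1 s = ![u, s, -1] := by
      ext i
      fin_cases i <;> simp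
    simpa only [hs] using (hasDerivAt_eval_update f ![u, v, -1] 1 v).deriv
  have hE := congrArg (eval ![u, v, -1]) hf.sum_X_mul_pderiv
  simp [Fin.sum_univ_three] at hE
  rw [hu, hv]
  simp only [map_add, map_mul]
  linear_combination eval ![u, v, -1] R * hE

/-- For a homogeneous polynomial vector field `X = (P,Q,R)` of degree `m`
on `S²` and a homogeneous polynomial `f` of degree `n` with `f(x,y,0)` not identically zero,
`f = 0` is an invariant algebraic surface of `X` if and only if `f(u,v,-1) = 0` is an
invariant algebraic curve of the centrally projected planar field
`(P(u,v,-1)+uR(u,v,-1), Q(u,v,-1)+vR(u,v,-1))`. -/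
theorem stmt15 (m n : ℕ) (P Q R f : MvPolynomial (Fin 3) ℝ)
    (hP : P.IsHomogeneous m) (hQ : Q.IsHomogeneous m) (hR : R.IsHomogeneous m)
    (htan : ∀ p : Fin 3 → ℝ, p 0 ^ 2 + p 1 ^ 2 + p 2 ^ 2 = 1 →
      p 0 * eval p P + p 1 * eval p Q + p 2 * eval p R = 0)
    (hf : f.IsHomogeneous n)
    (hf0 : ¬ ∀ x y : ℝ, eval ![x, y, 0] f = 0) :
    (∃ K : MvPolynomial (Fin 3) ℝ, ∀ p : Fin 3 → ℝ,
        eval p P * eval p (pderiv 0 f) + eval p Q * eval p (pderiv 1 f)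
          + eval p R * eval p (pderiv 2 f) = eval p K * eval p f) ↔
    (∃ k : MvPolynomial (Fin 2) ℝ, ∀ u v : ℝ,
        (eval ![u, v, -1] P + u * eval ![u, v, -1] R) * deriv (fun s => eval ![s, v, -1] f) u
          + (eval ![u, v, -1] Q + v * eval ![u, v, -1] R) *
              deriv (fun s => eval ![u, s, -1] f) v
          = eval ![u, v] k * eval ![u, v, -1] f) := by
  set D := P * pderiv 0 f + Q * pderiv 1 f + R * pderiv 2 f with hD
  simp_rw [projected_eq hf, ← hD]
  have hres (A : MvPolynomial (Fin 3) ℝ) (u v : ℝ) :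
      eval ![u, v] (aeval ![X 0, X 1, -1] A) = eval ![u, v, -1] A := by
    rw [← bind₁, ← coe_aeval_eq_eval, ← coe_aeval_eq_eval, RingHom.coe_coe, RingHom.coe_coe,
      aeval_bind₁]
    congr 2
    ext i
    fin_cases i <;> simp
  constructor
  · rintro ⟨K, hK⟩
    refine ⟨aeval ![X 0, X 1, -1] (K + C (n : ℝ) * R), fun u v => ?_⟩
    rw [hres]
    have := hK ![u, v, -1]
    simp only [hD, map_add, map_mul, eval_C]
    linear_combination this
  · rintro ⟨k, hk⟩
    have hDhom : D.IsHomogeneous (m + (n - 1)) :=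
      ((hP.mul hf.pderiv).add (hQ.mul hf.pderiv)).add (hR.mul hf.pderiv)
    obtain ⟨K, hK⟩ := dvd_of_eval_plane hDhom hf (X_two_not_dvd hf0)
      (k - aeval ![X 0, X 1, -1] (C (n : ℝ) * R)) fun u v => by
        rw [map_sub, hres, map_mul, eval_C]
        linear_combination hk u v
    refine ⟨K, fun p => ?_⟩
    have := congrArg (eval p) hK
    simp only [hD, map_add, map_mul] at this
    linear_combination this
end
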